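/- arXiv:2408.13165 — 5 statements merged into one kernel-verified Lean document; each statement's English description precedes it below -/
import Mathlib

section
/- For any (K, L, M_a, M_p, N) CW-MAP caching scheme with N ≥ K ≥ 1, L ≥ 1, file size B ≥ 1 and worst-case rate R, the rate satisfies R ≥ max_{s ∈ {1,...,K}} ( s − (min(s+L−1, K)·M_a + s·M_p) / ⌊N/s⌋ ). In particular this lower bound on the optimal worst-case rate holds for both coded and uncoded placement. -/
/-- A `(K, L, M_a, M_p, N)` CW-MAP caching scheme with file size `B`.
Files are elements of `{0,1}^B`; each of the `K` access caches stores at most `Ma * B` bits,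
each of the `K` users' private caches stores at most `Mp * B` bits, the broadcast for demand
vector `d` is a bit string (of length `bLen d`), and user `u` can decode its demanded file
`W (d u)` from the broadcast, the contents of the `L` access caches `u, u+1, ..., u+L-1`
(mod `K`), and its private cache. -/
structure CWMAPScheme (K L N B : ℕ) (Ma Mp : ℝ) where
  hK : 0 < K
  aLen : Fin K → ℕ
  aLen_le : ∀ k : Fin K, (aLen k : ℝ) ≤ Ma * B
  aPlace : (k : Fin K) → (Fin N → Fin B → Bool) → (Fin (aLen k) → Bool)
  pLen : Fin K → ℕ
  pLen_le : ∀ u : Fin K, (pLen u : ℝ) ≤ Mp * B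
  pPlace : (u : Fin K) → (Fin N → Fin B → Bool) → (Fin (pLen u) → Bool)
  bLen : (Fin K → Fin N) → ℕ
  bEnc : (d : Fin K → Fin N) → (Fin N → Fin B → Bool) → (Fin (bLen d) → Bool)
  decode : (u : Fin K) → (d : Fin K → Fin N) →
    (Fin (bLen d) → Bool) →
    ((j : Fin L) → Fin (aLen ⟨((u : ℕ) + (j : ℕ)) % K, Nat.mod_lt _ hK⟩) → Bool) →
    (Fin (pLen u) → Bool) → (Fin B → Bool)
  decode_correct : ∀ (u : Fin K) (d : Fin K → Fin N) (W : Fin N → Fin B → Bool),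
    decode u d (bEnc d W)
      (fun j => aPlace ⟨((u : ℕ) + (j : ℕ)) % K, Nat.mod_lt _ hK⟩ W) (pPlace u W) = W (d u)

/-- The scheme has worst-case rate at most `R`: every broadcast has length at most `R * B`. -/
def CWMAPScheme.rateLE {K L N B : ℕ} {Ma Mp : ℝ} (C : CWMAPScheme K L N B Ma Mp) (R : ℝ) : Prop :=
  ∀ d : Fin K → Fin N, (C.bLen d : ℝ) ≤ R * B

namespace CWMAPScheme

variable {K L N B : ℕ} {Ma Mp : ℝ}

/-- The file tuple whose first `n` files are `V` and whose other files are zero. -/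
def padFiles (N : ℕ) {n : ℕ} (V : Fin n → Fin B → Bool) : Fin N → Fin B → Bool :=
  fun j => if h : (j : ℕ) < n then V ⟨j, h⟩ else fun _ => false

/-- The demand vector in which users `0, ..., s - 1` request the `i`-th block of `s` consecutive
files. -/
def blockDemand (K : ℕ) {N s m : ℕ} (hs : 0 < s) (hN : m * s ≤ N) (i : Fin m) :
    Fin K → Fin N :=
  fun u => ⟨i * s + u % s, by
    have h₁ := Nat.mod_lt u hs
    have h₂ : (i + 1) * s ≤ m * s := Nat.mul_le_mul_right s i.isLt
    linarith⟩

/-- If the broadcast for `d`, the access caches reachable by user `u` and the private cache of `u`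
agree on two file tuples, then so does the file requested by `u`. -/
theorem requested_file_eq (C : CWMAPScheme K L N B Ma Mp) (u : Fin K) (d : Fin K → Fin N)
    {W W' : Fin N → Fin B → Bool} (hb : C.bEnc d W = C.bEnc d W')
    (ha : ∀ j : Fin L, C.aPlace ⟨((u : ℕ) + (j : ℕ)) % K, Nat.mod_lt _ C.hK⟩ W =
      C.aPlace ⟨((u : ℕ) + (j : ℕ)) % K, Nat.mod_lt _ C.hK⟩ W')
    (hp : C.pPlace u W = C.pPlace u W') : W (d u) = W' (d u) := by
  rw [← C.decode_correct u d W, ← C.decode_correct u d W', hb, hp]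
  congr 1
  exact funext ha

/-- Counting form of the cut-set bound: the caches seen by the first `s` users, together with
the broadcasts for `m` block demands, hold at least as many bits as `m * s` files. -/
theorem cutset_bits_le (C : CWMAPScheme K L N B Ma Mp) {s m : ℕ} (hs : 0 < s) (hsK : s ≤ K)
    (hN : m * s ≤ N) :
    m * s * B ≤ ∑ k : Fin (min (s + L - 1) K), C.aLen (k.castLE (min_le_right _ _)) +
      ∑ u : Fin s, C.pLen (u.castLE hsK) +
      ∑ i : Fin m, C.bLen (blockDemand K hs hN i) := by
  let F : (Fin (m * s) → Fin B → Bool) →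
      ((k : Fin (min (s + L - 1) K)) → Fin (C.aLen (k.castLE (min_le_right _ _))) → Bool) ×
      ((u : Fin s) → Fin (C.pLen (u.castLE hsK)) → Bool) ×
      ((i : Fin m) → Fin (C.bLen (blockDemand K hs hN i)) → Bool) :=
    fun V => (fun k => C.aPlace _ (padFiles N V), fun u => C.pPlace _ (padFiles N V),
      fun i => C.bEnc _ (padFiles N V))
  have hF : Function.Injective F := by
    intro V V' h
    have ha := congrArg Prod.fst h
    have hp := congrArg (fun x => x.2.1) h
    have hb := congrArg (fun x => x.2.2) h
    funext n
    have hi : (n : ℕ) / s < m := (Nat.div_lt_iff_lt_mul hs).2 n.isLt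
    have hu : (n : ℕ) % s < s := Nat.mod_lt _ hs
    have key := C.requested_file_eq ((⟨n % s, hu⟩ : Fin s).castLE hsK)
      (blockDemand K hs hN ⟨n / s, hi⟩) (congrFun hb ⟨n / s, hi⟩) ?_ (congrFun hp ⟨n % s, hu⟩)
    · have hd : blockDemand K hs hN ⟨n / s, hi⟩ ((⟨n % s, hu⟩ : Fin s).castLE hsK) =
          n.castLE hN := by
        ext
        simp [blockDemand, Nat.div_add_mod']
      rw [hd] at key
      simpa [padFiles] using key
    · intro j
      have hlt : ((n : ℕ) % s + j) % K < min (s + L - 1) K := by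
        refine lt_min ((Nat.mod_le _ _).trans_lt ?_) (Nat.mod_lt _ C.hK)
        have := j.isLt
        omega
      exact congrFun ha ⟨_, hlt⟩
  have hcard := Fintype.card_le_of_injective F hF
  simp only [Fintype.card_prod, Fintype.card_pi, Fintype.card_bool, Finset.prod_const,
    Finset.card_univ, Fintype.card_fin, Finset.prod_pow_eq_pow_sum, ← pow_mul, ← pow_add] at hcard
  have := (Nat.pow_le_pow_iff_right (by norm_num : 1 < 2)).1 hcard
  linarith

end CWMAPScheme

/-- **Cut-set lower bound on the worst-case rate (Theorem 1).**
For any `(K, L, M_a, M_p, N)` CW-MAP caching scheme with `N ≥ K ≥ 1`, `L ≥ 1`, file size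
`B ≥ 1`, and worst-case rate `R`, we have
`R ≥ max_{s ∈ [K]} (s − (min(s+L−1, K)·M_a + s·M_p) / ⌊N/s⌋)`.
The bound holds for both coded and uncoded placement. -/
theorem cwmap_cutset_rate_lower_bound
    (K L N B : ℕ) (Ma Mp R : ℝ) (hMa : 0 ≤ Ma) (hMp : 0 ≤ Mp) (hR : 0 ≤ R)
    (hK : 1 ≤ K) (hKN : K ≤ N) (hL : 1 ≤ L) (hB : 1 ≤ B)
    (C : CWMAPScheme K L N B Ma Mp) (hrate : C.rateLE R) :
    ∀ s ∈ Finset.Icc 1 K,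
      (s : ℝ) - ((min (s + L - 1) K : ℕ) * Ma + (s : ℝ) * Mp) / ((N / s : ℕ) : ℝ) ≤ R := by
  intro s hs
  obtain ⟨hs1, hsK⟩ := Finset.mem_Icc.1 hs
  have hm : 0 < N / s := Nat.div_pos (hsK.trans hKN) hs1
  have hbits : ((N / s * s * B : ℕ) : ℝ) ≤ _ :=
    Nat.cast_le.2 (C.cutset_bits_le hs1 hsK (Nat.div_mul_le_self N s))
  simp only [Nat.cast_add, Nat.cast_sum, Nat.cast_mul] at hbits
  have ha := Finset.sum_le_card_nsmul Finset.univ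
    (fun k : Fin (min (s + L - 1) K) => (C.aLen (k.castLE (min_le_right _ _)) : ℝ)) (Ma * B)
    fun k _ => C.aLen_le _
  have hp := Finset.sum_le_card_nsmul Finset.univ
    (fun u : Fin s => (C.pLen (u.castLE hsK) : ℝ)) (Mp * B) fun u _ => C.pLen_le _
  have hb := Finset.sum_le_card_nsmul Finset.univ
    (fun i : Fin (N / s) => (C.bLen (CWMAPScheme.blockDemand K hs1
      (Nat.div_mul_le_self N s) i) : ℝ)) (R * B) fun i _ => hrate _
  simp only [Finset.card_univ, Fintype.card_fin, nsmul_eq_mul] at ha hp hb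
  have hm' : (0 : ℝ) < ((N / s : ℕ) : ℝ) := Nat.cast_pos.2 hm
  have hB' : (0 : ℝ) < B := Nat.cast_pos.2 hB
  rw [sub_le_iff_le_add, ← sub_le_iff_le_add', le_div_iff₀ hm']
  refine le_of_mul_le_mul_right ?_ hB'
  linarith
end

section
/- Let K, L, N, γ_a, γ_p be integers with N ≥ K ≥ 1, L ≥ 1, γ_a ≥ 0, 0 ≤ γ_p < γ_a·L, and γ_a·L + γ_p < K. Set t = γ_a·L, M_a = N·γ_a/K, M_p = N·γ_p/K, and let C(n,k) denote the binomial coefficient with the convention C(n,k) = 0 whenever n < 0, k < 0, or n < k, and x⁺ = max(0,x). Then for every file size B that is a multiple of F = K·C(K−t, γ_p), there exists a (K, L, M_a, M_p, N) CW-MAP caching scheme with uncoded placement whose broadcast length for every demand vector is at most R·B, where R equals [ (1+γ_p)·( C(K−t, 1+γ_p) + (K−1)·C(K−t−1, 1+γ_p) − Σ_{i=1}^{t−1} C(K−t−1−(t−i), 1+γ_p−(t−i)) ) − γ_p·K·C(K−t−2, 1+γ_p) − η·𝟙{γ_p = t−1} ] / ( K·C(K−t, γ_p) ), with η = (1+γ_p)·(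 ((K−2t)(K−2t+1)/2)⁺ + ((t−1)(K−2t−1))⁺ ) − γ_p·K·(K−2t−1)⁺ + γ_p·( (1+t)(K−2t−1) + (K−2t−2)(K−2t−1)/2 ). In particular, the worst-case rate R is achievable with subpacketization F. -/
/-- A placement is *uncoded* if every cached bit (in any access cache or private cache)
is a copy of a bit of one of the files. -/
def CWMAPScheme.Uncoded {K L N B : ℕ} {Ma Mp : ℝ} (C : CWMAPScheme K L N B Ma Mp) : Prop :=
  (∀ (k : Fin K) (i : Fin (C.aLen k)), ∃ (n : Fin N) (b : Fin B),
      ∀ W : Fin N → Fin B → Bool, C.aPlace k W i = W n b) ∧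
  (∀ (u : Fin K) (i : Fin (C.pLen u)), ∃ (n : Fin N) (b : Fin B),
      ∀ W : Fin N → Fin B → Bool, C.pPlace u W i = W n b)

/-- Binomial coefficient on integers with the convention `C(n,k) = 0` whenever
`n < 0`, `k < 0`, or `n < k`. -/
def binomZ (n k : ℤ) : ℤ :=
  if 0 ≤ n ∧ 0 ≤ k ∧ k ≤ n then n.toNat.choose k.toNat else 0

/-- The correction term `η` appearing in the rate expression (with `t = γ_a·L`);
here `x⁺ = max 0 x`. -/
noncomputable def cwmapEta (K t γp : ℕ) : ℝ :=
  (1 + (γp : ℝ)) *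
      (max 0 (((K : ℝ) - 2 * t) * ((K : ℝ) - 2 * t + 1) / 2) +
        max 0 (((t : ℝ) - 1) * ((K : ℝ) - 2 * t - 1)))
    - (γp : ℝ) * (K : ℝ) * max 0 ((K : ℝ) - 2 * t - 1)
    + (γp : ℝ) * ((1 + (t : ℝ)) * ((K : ℝ) - 2 * t - 1) +
        ((K : ℝ) - 2 * t - 2) * ((K : ℝ) - 2 * t - 1) / 2)

/-- The achievable worst-case rate `R_{M_a,M_p}` of the proposed scheme, with `t = γ_a·L`. -/
noncomputable def cwmapRate (K t γp : ℕ) : ℝ :=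
  ((1 + (γp : ℝ)) *
      ((binomZ ((K : ℤ) - t) (1 + γp) : ℝ) +
        ((K : ℝ) - 1) * (binomZ ((K : ℤ) - t - 1) (1 + γp) : ℝ) -
        ∑ i ∈ Finset.Icc 1 (t - 1),
          (binomZ ((K : ℤ) - t - 1 - ((t : ℤ) - i)) (1 + (γp : ℤ) - ((t : ℤ) - i)) : ℝ))
    - (γp : ℝ) * (K : ℝ) * (binomZ ((K : ℤ) - t - 2) (1 + γp) : ℝ)
    - (if (γp : ℤ) = (t : ℤ) - 1 then cwmapEta K t γp else 0)) /
    ((K : ℝ) * ((K - t).choose γp : ℝ))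

/-- An uncoded placement, given by the sets of file bits that are stored, together with an encoder
that determines every demanded file from the cached bits yields a caching scheme. -/
theorem CWMAPScheme.exists_of_determined {K L N B : ℕ} {Ma Mp : ℝ} (hK : 0 < K)
    (A P : Fin K → Finset (Fin N × Fin B))
    (hA : ∀ k, ((A k).card : ℝ) ≤ Ma * B) (hP : ∀ u, ((P u).card : ℝ) ≤ Mp * B)
    {J : Type} [Fintype J]
    (enc : (Fin K → Fin N) → (Fin N → Fin B → Bool) → J → ZMod 2)
    (hdet : ∀ (u : Fin K) (d : Fin K → Fin N) (W W' : Fin N → Fin B → Bool),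
      enc d W = enc d W' →
      (∀ j : Fin L, ∀ x ∈ A ⟨((u : ℕ) + (j : ℕ)) % K, Nat.mod_lt _ hK⟩,
        W x.1 x.2 = W' x.1 x.2) →
      (∀ x ∈ P u, W x.1 x.2 = W' x.1 x.2) → W (d u) = W' (d u)) :
    ∃ C : CWMAPScheme K L N B Ma Mp, C.Uncoded ∧ ∀ d, C.bLen d = Fintype.card J := by
  classical
  let aPl : (k : Fin K) → (Fin N → Fin B → Bool) → (Fin (A k).card → Bool) := fun k W i =>
    W ((A k).equivFin.symm i).1.1 ((A k).equivFin.symm i).1.2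
  let pPl : (u : Fin K) → (Fin N → Fin B → Bool) → (Fin (P u).card → Bool) := fun u W i =>
    W ((P u).equivFin.symm i).1.1 ((P u).equivFin.symm i).1.2
  let bE : (Fin K → Fin N) → (Fin N → Fin B → Bool) → (Fin (Fintype.card J) → Bool) :=
    fun d W i => decide (enc d W ((Fintype.equivFin J).symm i) = 1)
  have hbE : ∀ d W W', bE d W = bE d W' → enc d W = enc d W' := by
    intro d W W' h
    funext j
    have h1 := congrFun h (Fintype.equivFin J j)
    simp only [bE, Equiv.symm_apply_apply, decide_eq_decide] at h1
    have key : ∀ x y : ZMod 2, (x = 1 ↔ y = 1) → x = y := by decide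
    exact key _ _ h1
  have haPl : ∀ k W W', aPl k W = aPl k W' → ∀ x ∈ A k, W x.1 x.2 = W' x.1 x.2 := by
    intro k W W' h x hx
    simpa [aPl] using congrFun h ((A k).equivFin ⟨x, hx⟩)
  have hpPl : ∀ u W W', pPl u W = pPl u W' → ∀ x ∈ P u, W x.1 x.2 = W' x.1 x.2 := by
    intro k W W' h x hx
    simpa [pPl] using congrFun h ((P k).equivFin ⟨x, hx⟩)
  refine ⟨{ hK := hK, aLen := fun k => (A k).card, aLen_le := hA, aPlace := aPl,
            pLen := fun u => (P u).card, pLen_le := hP, pPlace := pPl,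
            bLen := fun _ => Fintype.card J, bEnc := bE,
            decode := fun u d b a p =>
              if h : ∃ W, bE d W = b ∧
                (fun j : Fin L => aPl ⟨((u : ℕ) + (j : ℕ)) % K, Nat.mod_lt _ hK⟩ W) = a ∧
                pPl u W = p
              then h.choose (d u) else fun _ => false,
            decode_correct := ?_ }, ⟨?_, ?_⟩, fun _ => rfl⟩
  · intro u d W
    have h : ∃ W', bE d W' = bE d W ∧
        (fun j : Fin L => aPl ⟨((u : ℕ) + (j : ℕ)) % K, Nat.mod_lt _ hK⟩ W') =
          (fun j : Fin L => aPl ⟨((u : ℕ) + (j : ℕ)) % K, Nat.mod_lt _ hK⟩ W) ∧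
        pPl u W' = pPl u W := ⟨W, rfl, rfl, rfl⟩
    rw [dif_pos h]
    obtain ⟨h1, h2, h3⟩ := h.choose_spec
    exact hdet u d _ _ (hbE _ _ _ h1) (fun j => haPl _ _ _ (congrFun h2 j)) (hpPl _ _ _ h3)
  · exact fun k i => ⟨_, _, fun W => rfl⟩
  · exact fun k i => ⟨_, _, fun W => rfl⟩

/-- A linear index code for the delivery phase. Bit `Z k T o` stands for the bit of part `k` with
label `T` of the file demanded by user `k + 1 + o`. A user `u` knows part `k` unless it is of the
form `k + 1 + o'`, in which case it knows exactly the bits whose label contains `o'`. -/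
def IsDeliveryCode (K m p : ℕ) {J : Type}
    (E : (ZMod K → Finset (Fin m) → Fin m → ZMod 2) →+ (J → ZMod 2)) : Prop :=
  ∀ (u : ZMod K) (Z : ZMod K → Finset (Fin m) → Fin m → ZMod 2), E Z = 0 →
    (∀ k (T : Finset (Fin m)) (o : Fin m), T.card = p → o ∉ T →
      ((∀ o' : Fin m, u ≠ k + 1 + (o' : ℕ)) ∨ ∃ o' ∈ T, u = k + 1 + (o' : ℕ)) → Z k T o = 0) →
    ∀ k (T : Finset (Fin m)) (o : Fin m), T.card = p → o ∉ T → u = k + 1 + (o : ℕ) → Z k T o = 0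

theorem exists_access_or_exists_miss {K L γa m : ℕ} (hL : 1 ≤ L) (hK : K = γa * L + m)
    [NeZero K] (u k : ZMod K) :
    (∃ (j : Fin L) (i : Fin γa), k = u + (j : ℕ) + ((i : ℕ) * L : ℕ)) ∨
      ∃ o : Fin m, u = k + 1 + (o : ℕ) := by
  have hv : (k - u).val < K := ZMod.val_lt _
  have hk : k = u + ((k - u).val : ℕ) := by rw [ZMod.natCast_zmod_val]; ring
  set v := (k - u).val with hvdef
  by_cases h : v < γa * L
  · left
    refine ⟨⟨v % L, Nat.mod_lt _ hL⟩, ⟨v / L, Nat.div_lt_of_lt_mul (by rwa [mul_comm])⟩, ?_⟩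
    rw [hk, add_assoc, ← Nat.cast_add]
    congr 2
    have := Nat.mod_add_div v L
    rw [mul_comm] at this
    exact this.symm
  · right
    refine ⟨⟨K - 1 - v, by omega⟩, ?_⟩
    have h1 : ((v + 1 + (K - 1 - v) : ℕ) : ZMod K) = 0 := by
      have : v + 1 + (K - 1 - v) = K := by omega
      rw [this, ZMod.natCast_self]
    push_cast at h1
    linear_combination -hk - h1

theorem CWMAPScheme.exists_of_isDeliveryCode {K L N γa m p c B : ℕ} (hL : 1 ≤ L)
    (hKm : K = γa * L + m) (hK : 0 < K) (hB : B = c * (K * m.choose p))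
    {J : Type} [Fintype J]
    (E : (ZMod K → Finset (Fin m) → Fin m → ZMod 2) →+ (J → ZMod 2))
    (hE : IsDeliveryCode K m p E) :
    ∃ C : CWMAPScheme K L N B ((N : ℝ) * γa / K) ((N : ℝ) * p / K),
      C.Uncoded ∧ ∀ d, C.bLen d = c * Fintype.card J := by
  classical
  have : NeZero K := ⟨hK.ne'⟩
  have hKR : (K : ℝ) ≠ 0 := by exact_mod_cast hK.ne'
  let Lab := {T : Finset (Fin m) // T.card = p}
  have hLab : Fintype.card Lab = m.choose p := by simp [Lab]
  have e : Fin B ≃ Fin c × ZMod K × Lab :=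
    Fintype.equivOfCardEq (by
      rw [Fintype.card_prod, Fintype.card_prod, hLab, ZMod.card, Fintype.card_fin,
        Fintype.card_fin, hB])
  let A : Fin K → Finset (Fin N × Fin B) := fun k => Finset.univ.image
    fun x : Fin N × Fin c × Fin γa × Lab =>
      (x.1, e.symm (x.2.1, ((k : ℕ) : ZMod K) + ((x.2.2.1 : ℕ) * L : ℕ), x.2.2.2))
  let P : Fin K → Finset (Fin N × Fin B) := fun u => Finset.univ.image
    fun x : Fin N × Fin c × (T : Lab) × {o // o ∈ T.1} =>
      (x.1, e.symm (x.2.1, ((u : ℕ) : ZMod K) - 1 - ((x.2.2.2.1 : ℕ) : ZMod K), x.2.2.1))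
  let usr : ZMod K → Fin K := fun x => ⟨x.val, ZMod.val_lt x⟩
  have husr : ∀ u : Fin K, usr ((u : ℕ) : ZMod K) = u := fun u => by
    ext; simp [usr, ZMod.val_natCast, Nat.mod_eq_of_lt u.2]
  let bit : Bool → ZMod 2 := fun b => if b then 1 else 0
  have hbit : ∀ a b, bit a - bit b = 0 → a = b := by decide
  let Zf : (Fin K → Fin N) → (Fin N → Fin B → Bool) → Fin c →
      ZMod K → Finset (Fin m) → Fin m → ZMod 2 := fun d W s k T o =>
    if hT : T.card = p then bit (W (d (usr (k + 1 + (o : ℕ)))) (e.symm (s, k, ⟨T, hT⟩))) else 0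
  have hcard : Fintype.card (Fin c × J) = c * Fintype.card J := by simp
  rw [← hcard]
  refine CWMAPScheme.exists_of_determined hK A P ?_ ?_
    (fun d W x => E (Zf d W x.1) x.2) ?_
  · intro k
    have h1 : (A k).card ≤ N * (c * (γa * m.choose p)) := by
      refine Finset.card_image_le.trans (le_of_eq ?_)
      simp only [Finset.card_univ, Fintype.card_prod, Fintype.card_fin, hLab]
    calc ((A k).card : ℝ) ≤ ((N * (c * (γa * m.choose p)) : ℕ) : ℝ) := by exact_mod_cast h1
      _ = _ := by rw [hB]; push_cast; field_simp
  · intro u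
    have h1 : (P u).card ≤ N * (c * (m.choose p * p)) := by
      refine Finset.card_image_le.trans (le_of_eq ?_)
      have : ∀ T : Lab, T.1.card = p := fun T => T.2
      simp only [Finset.card_univ, Fintype.card_prod, Fintype.card_fin, Fintype.card_sigma,
        Fintype.card_coe, this, Finset.sum_const, smul_eq_mul, hLab]
    calc ((P u).card : ℝ) ≤ ((N * (c * (m.choose p * p)) : ℕ) : ℝ) := by exact_mod_cast h1
      _ = _ := by rw [hB]; push_cast; field_simp
  · intro u d W W' henc hAcc hPriv
    have hacc : ∀ n s k T, (∀ o' : Fin m, ((u : ℕ) : ZMod K) ≠ k + 1 + (o' : ℕ)) →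
        W n (e.symm (s, k, T)) = W' n (e.symm (s, k, T)) := by
      intro n s k T hk
      rcases exists_access_or_exists_miss hL hKm ((u : ℕ) : ZMod K) k with ⟨j, i, h⟩ | ⟨o, h⟩
      · refine hAcc j (n, e.symm (s, k, T)) (Finset.mem_image.2
          ⟨(n, s, i, T), Finset.mem_univ _, ?_⟩)
        simp [h]
      · exact absurd h (hk o)
    have hpriv : ∀ n s k (T : Lab), (∃ o' ∈ T.1, ((u : ℕ) : ZMod K) = k + 1 + (o' : ℕ)) →
        W n (e.symm (s, k, T)) = W' n (e.symm (s, k, T)) := by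
      rintro n s k T ⟨o, ho, h⟩
      refine hPriv (n, e.symm (s, k, T)) (Finset.mem_image.2
          ⟨(n, s, ⟨T, ⟨o, ho⟩⟩), Finset.mem_univ _, ?_⟩)
      simp only [Prod.mk.injEq, EmbeddingLike.apply_eq_iff_eq, true_and, and_true]
      rw [h]; ring
    have main : ∀ s k (T : Finset (Fin m)) (o : Fin m), T.card = p → o ∉ T → ((u : ℕ) : ZMod K) = k + 1 + ((o : ℕ) : ZMod K) →
        (Zf d W s - Zf d W' s) k T o = 0 := by
      intro s
      refine hE _ _ ?_ ?_
      · rw [map_sub, sub_eq_zero]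
        funext j
        exact congrFun henc (s, j)
      · intro k T o hT _ h
        simp only [Zf, Pi.sub_apply, dif_pos hT, sub_eq_zero]
        rcases h with h | h
        · rw [hacc _ _ _ _ h]
        · rw [hpriv _ _ _ ⟨T, hT⟩ h]
    funext b
    obtain ⟨⟨s, k, T, hT⟩, rfl⟩ := e.symm.surjective b
    by_cases hk : ∃ o : Fin m, ((u : ℕ) : ZMod K) = k + 1 + (o : ℕ)
    · obtain ⟨o, ho⟩ := hk
      by_cases hoT : o ∈ T
      · exact hpriv _ _ _ _ ⟨o, hoT, ho⟩
      · have h := main s k T o hT hoT ho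
        simp only [Zf, Pi.sub_apply, dif_pos hT, ← ho, husr] at h
        exact hbit _ _ h
    · exact hacc _ _ _ _ (not_exists.1 hk)

/-- The multicast messages: a part `k` together with a set of `p + 1` users lacking that part. -/
abbrev MulticastIndex (K m p : ℕ) : Type := ZMod K × {S : Finset (Fin m) // S.card = p + 1}

/-- The multicast message for `(k, S)` is the sum of the bits wanted by the members of `S`. -/
def multicast (K m p : ℕ) :
    (ZMod K → Finset (Fin m) → Fin m → ZMod 2) →+ (MulticastIndex K m p → ZMod 2) where
  toFun Z x := ∑ o ∈ x.2.1, Z x.1 (x.2.1.erase o) o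
  map_zero' := by funext x; simp
  map_add' Z Z' := by funext x; simp [Finset.sum_add_distrib]

theorem card_multicastIndex (K m p : ℕ) [NeZero K] :
    Fintype.card (MulticastIndex K m p) = K * m.choose (p + 1) := by
  simp [MulticastIndex, ZMod.card]

theorem two_mul_card_lt_involution {Q : Type*} [Fintype Q] {n : ℕ} (e : Q ≃ Fin n) {τ : Q → Q}
    (hτ : Function.Involutive τ) (hne : ∀ y, τ y ≠ y) :
    2 * Fintype.card {y : Q // e y < e (τ y)} = Fintype.card Q := by
  classical
  have h1 : Fintype.card {y : Q // e y < e (τ y)} = Fintype.card {y : Q // ¬ e y < e (τ y)} := by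
    refine Fintype.card_congr (Equiv.subtypeEquiv hτ.toPerm fun y => ?_)
    have : e (τ y) ≠ e y := fun h => hne y (e.injective h)
    simp only [Function.Involutive.coe_toPerm, hτ y, not_lt]
    exact ⟨le_of_lt, fun h => lt_of_le_of_ne h this.symm⟩
  have h2 := Fintype.card_subtype_compl (fun y : Q => e y < e (τ y))
  have h3 := Fintype.card_subtype_le (fun y : Q => e y < e (τ y))
  omega

/-- Two multicast messages can be sent as their sum whenever each receiver of one of them knows the
part the other one belongs to. -/
theorem exists_isDeliveryCode_of_pairing {K m p : ℕ} [NeZero K] {Q : Type} [Fintype Q]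
    {φ : Q → MulticastIndex K m p} (hφ : Function.Injective φ) {τ : Q → Q}
    (hτ : Function.Involutive τ) (hne : ∀ y, τ y ≠ y)
    (hcompat : ∀ y, ∀ o ∈ (φ y).2.1, ∀ o' : Fin m,
      (φ y).1 + 1 + ((o : ℕ) : ZMod K) ≠ (φ (τ y)).1 + 1 + ((o' : ℕ) : ZMod K)) :
    ∃ (J : Type) (_ : Fintype J)
      (E : (ZMod K → Finset (Fin m) → Fin m → ZMod 2) →+ (J → ZMod 2)),
      IsDeliveryCode K m p E ∧
        2 * Fintype.card J + Fintype.card Q = 2 * (K * m.choose (p + 1)) := by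
  classical
  let e := Fintype.equivFin Q
  let J := {x : MulticastIndex K m p // x ∉ Set.range φ} ⊕ {y : Q // e y < e (τ y)}
  let Y := multicast K m p
  let E : (ZMod K → Finset (Fin m) → Fin m → ZMod 2) →+ (J → ZMod 2) :=
    { toFun := fun Z => Sum.elim (fun x => Y Z x.1) (fun y => Y Z (φ y.1) + Y Z (φ (τ y.1)))
      map_zero' := by funext j; rcases j with j | j <;> simp
      map_add' := fun Z Z' => by
        funext j
        rcases j with j | j
        · simp
        · simp only [map_add, Pi.add_apply, Sum.elim_inr]; ring }
  refine ⟨J, inferInstance, E, ?_, ?_⟩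
  · intro u Z h0 hknown k T o hT ho hu
    have hS : (insert o T).card = p + 1 := by rw [Finset.card_insert_of_notMem ho, hT]
    have hY : Y Z (k, ⟨insert o T, hS⟩) = 0 := by
      by_cases hx : (k, (⟨insert o T, hS⟩ : {S : Finset (Fin m) // S.card = p + 1})) ∈ Set.range φ
      · obtain ⟨y, hy⟩ := hx
        have hsum : Y Z (φ y) + Y Z (φ (τ y)) = 0 := by
          rcases lt_trichotomy (e y) (e (τ y)) with h | h | h
          · exact congrFun h0 (Sum.inr ⟨y, h⟩)
          · exact absurd (e.injective h).symm (hne y)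
          · have h' : e (τ y) < e (τ (τ y)) := by rwa [hτ y]
            have h2 : Y Z (φ (τ y)) + Y Z (φ (τ (τ y))) = 0 := congrFun h0 (Sum.inr ⟨τ y, h'⟩)
            rwa [hτ y, add_comm] at h2
        have hother : Y Z (φ (τ y)) = 0 := by
          refine Finset.sum_eq_zero fun o' ho' => hknown _ _ _ ?_ ?_ (Or.inl fun o'' h => ?_)
          · rw [Finset.card_erase_of_mem ho', (φ (τ y)).2.2]; rfl
          · exact Finset.notMem_erase _ _
          · refine hcompat y o ?_ o'' ?_
            · rw [hy]; exact Finset.mem_insert_self _ _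
            · rw [← h, hu, hy]
        rw [← hy]
        rwa [hother, add_zero] at hsum
      · exact congrFun h0 (Sum.inl ⟨_, hx⟩)
    have hY' : ∑ x ∈ insert o T, Z k ((insert o T).erase x) x = 0 := hY
    rw [Finset.sum_insert ho, Finset.erase_insert ho, Finset.sum_eq_zero, add_zero] at hY'
    · exact hY'
    · intro x hx
      refine hknown _ _ _ ?_ (Finset.notMem_erase _ _) (Or.inr ⟨o, ?_, hu⟩)
      · rw [Finset.card_erase_of_mem (Finset.mem_insert_of_mem hx), hS]; rfl
      · exact Finset.mem_erase.2 ⟨fun h => ho (h ▸ hx), Finset.mem_insert_self _ _⟩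
  · have h1 := two_mul_card_lt_involution e hτ hne
    have h2 := Fintype.card_subtype_compl (fun x : MulticastIndex K m p => x ∈ Set.range φ)
    have h3 : Fintype.card {x : MulticastIndex K m p // x ∈ Set.range φ} = Fintype.card Q :=
      (Fintype.card_congr (Equiv.ofInjective φ hφ)).symm
    have h4 := Fintype.card_le_of_injective φ hφ
    have h5 := card_multicastIndex K m p
    have h6 : Fintype.card J = Fintype.card {x : MulticastIndex K m p // x ∉ Set.range φ} +
      Fintype.card {y : Q // e y < e (τ y)} := Fintype.card_sum
    omega

/-- The `p + 1` consecutive offsets starting at `e`. -/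
def offsetBlock (m p e : ℕ) : Finset (Fin m) :=
  Finset.univ.filter fun o => e ≤ (o : ℕ) ∧ (o : ℕ) ≤ e + p

theorem mem_offsetBlock {m p e : ℕ} {o : Fin m} :
    o ∈ offsetBlock m p e ↔ e ≤ (o : ℕ) ∧ (o : ℕ) ≤ e + p := by
  simp [offsetBlock]

theorem card_offsetBlock {m p e : ℕ} (h : e + p < m) : (offsetBlock m p e).card = p + 1 := by
  have : (offsetBlock m p e).map Fin.valEmbedding = Finset.Icc e (e + p) := by
    ext x
    simp only [Finset.mem_map, mem_offsetBlock, Fin.valEmbedding_apply, Finset.mem_Icc]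
    exact ⟨by rintro ⟨o, ho, rfl⟩; exact ho, fun hx => ⟨⟨x, by omega⟩, hx, rfl⟩⟩
  rw [← Finset.card_map Fin.valEmbedding, this, Nat.card_Icc]
  omega

theorem offsetBlock_injOn {m p e e' : ℕ} (he : e + p < m) (he' : e' + p < m)
    (h : offsetBlock m p e = offsetBlock m p e') : e = e' := by
  have h1 : (⟨e, by omega⟩ : Fin m) ∈ offsetBlock m p e' := by
    rw [← h, mem_offsetBlock]; simp
  have h2 : (⟨e', by omega⟩ : Fin m) ∈ offsetBlock m p e := by
    rw [h, mem_offsetBlock]; simp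
  rw [mem_offsetBlock] at h1 h2
  exact le_antisymm h2.1 h1.1

theorem ZMod.natCast_ne_of_lt {K x y : ℕ} (h1 : x < y) (h2 : y < x + K) :
    (x : ZMod K) ≠ (y : ZMod K) := by
  intro h
  rw [ZMod.natCast_eq_natCast_iff] at h
  have := Nat.le_of_dvd (by omega) ((Nat.modEq_iff_dvd' h1.le).1 h)
  omega

/-- Pairing message `k` at block `0` with message `k + p + 1` at the last block saves `K` bits. -/
theorem exists_isDeliveryCode_saving_card {K t m p : ℕ} [NeZero K] (hK : K = t + m) (hpt : p < t)
    (hpm : p + 1 < m) :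
    ∃ (J : Type) (_ : Fintype J)
      (E : (ZMod K → Finset (Fin m) → Fin m → ZMod 2) →+ (J → ZMod 2)),
      IsDeliveryCode K m p E ∧ Fintype.card J + K = K * m.choose (p + 1) := by
  let φ : ZMod K × Bool → MulticastIndex K m p := fun y =>
    (y.1, bif y.2 then ⟨offsetBlock m p (m - p - 1), card_offsetBlock (by omega)⟩
      else ⟨offsetBlock m p 0, card_offsetBlock (by omega)⟩)
  let τ : ZMod K × Bool → ZMod K × Bool := fun y =>
    bif y.2 then (y.1 - (p + 1 : ℕ), false) else (y.1 + (p + 1 : ℕ), true)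
  have hblock : offsetBlock m p (m - p - 1) ≠ offsetBlock m p 0 := fun h => by
    have := offsetBlock_injOn (by omega) (by omega) h
    omega
  have hφ : Function.Injective φ := by
    rintro ⟨k, b⟩ ⟨k', b'⟩ h
    cases b <;> cases b' <;> simp [φ, hblock, hblock.symm] at h ⊢ <;> exact h
  have hτ : Function.Involutive τ := by
    rintro ⟨k, b⟩
    cases b <;> simp [τ]
  have hne : ∀ y, τ y ≠ y := by
    rintro ⟨k, b⟩
    cases b <;> simp [τ]
  have hcompat : ∀ y, ∀ o ∈ (φ y).2.1, ∀ o' : Fin m,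
      (φ y).1 + 1 + ((o : ℕ) : ZMod K) ≠ (φ (τ y)).1 + 1 + ((o' : ℕ) : ZMod K) := by
    rintro ⟨k, b⟩ o ho o' h
    cases b
    · have ho := mem_offsetBlock.1 ho
      refine ZMod.natCast_ne_of_lt (K := K) (x := o) (y := p + 1 + o') (by omega) (by omega) ?_
      simp only [φ, τ, cond_false] at h
      push_cast at h ⊢
      linear_combination h
    · have ho := mem_offsetBlock.1 ho
      refine ZMod.natCast_ne_of_lt (K := K) (x := o') (y := p + 1 + o) (by omega) (by omega) ?_
      simp only [φ, τ, cond_true] at h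
      push_cast at h ⊢
      linear_combination -h
  obtain ⟨J, hJ, E, hE, hcard⟩ := exists_isDeliveryCode_of_pairing hφ hτ hne hcompat
  refine ⟨J, hJ, E, hE, ?_⟩
  simp only [Fintype.card_prod, ZMod.card, Fintype.card_bool] at hcard
  omega

/-- When `t = p + 1`, all parts at cyclic distance at least `t` can be paired. -/
theorem exists_isDeliveryCode_pairing_all {K m p : ℕ} [NeZero K] (hK : K = (p + 1) + m) :
    ∃ (J : Type) (_ : Fintype J)
      (E : (ZMod K → Finset (Fin m) → Fin m → ZMod 2) →+ (J → ZMod 2)),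
      IsDeliveryCode K m p E ∧
        2 * Fintype.card J + K * (m - p) = 2 * (K * m.choose (p + 1)) := by
  let φ : ZMod K × Fin (m - p) → MulticastIndex K m p := fun y =>
    (y.1, ⟨offsetBlock m p y.2, card_offsetBlock (by omega)⟩)
  let τ : ZMod K × Fin (m - p) → ZMod K × Fin (m - p) := fun y =>
    (y.1 + ((y.2 : ℕ) + p + 1 : ℕ), y.2.rev)
  have hφ : Function.Injective φ := by
    rintro ⟨k, e⟩ ⟨k', e'⟩ h
    simp only [φ, Prod.mk.injEq, Subtype.mk.injEq] at h
    exact Prod.ext h.1 (Fin.ext (offsetBlock_injOn (by omega) (by omega) h.2))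
  have hτ : Function.Involutive τ := by
    rintro ⟨k, e⟩
    have he := e.2
    have h0 : ((((e : ℕ) + p + 1) + ((e.rev : ℕ) + p + 1) : ℕ) : ZMod K) = 0 := by
      rw [Fin.val_rev]
      have : (e : ℕ) + p + 1 + (m - p - (e + 1) + p + 1) = K := by omega
      rw [this, ZMod.natCast_self]
    simp only [τ, Fin.rev_rev, Prod.mk.injEq, and_true]
    rw [add_assoc, ← Nat.cast_add, h0, add_zero]
  have hne : ∀ y, τ y ≠ y := by
    rintro ⟨k, e⟩ h
    have he := e.2
    have h1 := congrArg Prod.fst h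
    simp only [τ, add_eq_left] at h1
    refine ZMod.natCast_ne_of_lt (K := K) (x := 0) (y := e + p + 1) (by omega) (by omega) ?_
    rw [h1, Nat.cast_zero]
  have hcompat : ∀ y, ∀ o ∈ (φ y).2.1, ∀ o' : Fin m,
      (φ y).1 + 1 + ((o : ℕ) : ZMod K) ≠ (φ (τ y)).1 + 1 + ((o' : ℕ) : ZMod K) := by
    rintro ⟨k, e⟩ o ho o' h
    have ho := mem_offsetBlock.1 ho
    simp only at ho
    refine ZMod.natCast_ne_of_lt (K := K) (x := o) (y := e + p + 1 + o') (by omega) (by omega) ?_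
    simp only [φ, τ] at h
    push_cast at h ⊢
    linear_combination h
  obtain ⟨J, hJ, E, hE, hcard⟩ := exists_isDeliveryCode_of_pairing hφ hτ hne hcompat
  refine ⟨J, hJ, E, hE, ?_⟩
  simpa only [Fintype.card_prod, ZMod.card, Fintype.card_fin] using hcard

/-- If only `p + 1` users lack each part, every missing bit is missing at a single user, and
`p + 1` bits suffice. -/
theorem exists_isDeliveryCode_of_eq {K p : ℕ} [NeZero K] :
    ∃ E : (ZMod K → Finset (Fin (p + 1)) → Fin (p + 1) → ZMod 2) →+ (Fin (p + 1) → ZMod 2),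
      IsDeliveryCode K (p + 1) p E := by
  refine ⟨{ toFun := fun Z j => ∑ k, Z k (Finset.univ.erase j) j
            map_zero' := by funext j; simp
            map_add' := fun Z Z' => by funext j; simp [Finset.sum_add_distrib] }, ?_⟩
  intro u Z h0 hknown k T o hT ho hu
  have hcard : (Finset.univ.erase o).card = p := by
    rw [Finset.card_erase_of_mem (Finset.mem_univ o), Finset.card_univ, Fintype.card_fin]; rfl
  have hTo : T = Finset.univ.erase o := by
    refine Finset.eq_of_subset_of_card_le (fun x hx => ?_) (by rw [hcard, hT])
    exact Finset.mem_erase.2 ⟨fun h => ho (h ▸ hx), Finset.mem_univ x⟩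
  have hsum : ∑ k', Z k' (Finset.univ.erase o) o = 0 := congrFun h0 o
  rw [Finset.sum_eq_single k] at hsum
  · rw [hTo]; exact hsum
  · intro k' _ hk'
    refine hknown _ _ _ hcard (Finset.notMem_erase _ _) ?_
    by_cases h : ∃ o' : Fin (p + 1), u = k' + 1 + ((o' : ℕ) : ZMod K)
    · obtain ⟨o', ho'⟩ := h
      refine Or.inr ⟨o', Finset.mem_erase.2 ⟨?_, Finset.mem_univ _⟩, ho'⟩
      rintro rfl
      exact hk' (by linear_combination hu - ho')
    · exact Or.inl (not_exists.1 h)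
  · exact fun h => absurd (Finset.mem_univ k) h

theorem binomZ_natCast (n k : ℕ) : binomZ n k = n.choose k := by
  unfold binomZ
  split_ifs with h
  · simp
  · rw [Nat.choose_eq_zero_of_lt (by omega)]; rfl

theorem binomZ_eq_zero {n k : ℤ} (h : n < 0 ∨ k < 0 ∨ n < k) : binomZ n k = 0 := by
  unfold binomZ
  rw [if_neg (by omega)]

theorem sum_range_binomZ_diag (s p n : ℕ) (h : n ≤ p + 1) :
    ∑ r ∈ Finset.range n, binomZ ((s : ℤ) + p - r) ((p : ℤ) - r) =
      (s + p + 1).choose p - if n = p + 1 then 0 else ((s + p + 1 - n).choose (p - n) : ℤ) := by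
  induction n with
  | zero => simp
  | succ n ih =>
    have hterm : binomZ ((s : ℤ) + p - n) ((p : ℤ) - n) = (s + p - n).choose (p - n) := by
      rw [← binomZ_natCast]
      congr 1 <;> omega
    rw [Finset.sum_range_succ, ih (by omega), hterm, if_neg (by omega)]
    obtain ⟨q, rfl⟩ := Nat.exists_eq_add_of_le (show n ≤ p by omega)
    rcases q with _ | q
    · simp
    · rw [if_neg (by omega)]
      have e1 : s + (n + (q + 1)) + 1 - n = (s + q + 1) + 1 := by omega
      have e2 : n + (q + 1) - n = q + 1 := by omega
      have e3 : s + (n + (q + 1)) - n = s + q + 1 := by omega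
      have e4 : s + (n + (q + 1)) + 1 - (n + 1) = s + q + 1 := by omega
      have e5 : n + (q + 1) - (n + 1) = q := by omega
      rw [e1, e2, e3, e4, e5, Nat.choose_succ_succ]
      push_cast
      ring

theorem sum_Icc_binomZ_reflect (K t p : ℕ) :
    ∑ i ∈ Finset.Icc 1 (t - 1),
        (binomZ ((K : ℤ) - t - 1 - ((t : ℤ) - i)) (1 + (p : ℤ) - ((t : ℤ) - i)) : ℝ) =
      ((∑ r ∈ Finset.range (t - 1), binomZ ((K : ℤ) - t - 2 - r) ((p : ℤ) - r) : ℤ) : ℝ) := by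
  push_cast
  refine Finset.sum_nbij' (fun i => t - 1 - i) (fun r => t - 1 - r) ?_ ?_ ?_ ?_ ?_
  · intro i hi; rw [Finset.mem_Icc] at hi; rw [Finset.mem_range]; omega
  · intro i hi; rw [Finset.mem_range] at hi; rw [Finset.mem_Icc]; omega
  · intro i hi; rw [Finset.mem_Icc] at hi; omega
  · intro i hi; rw [Finset.mem_range] at hi; omega
  · intro i hi
    rw [Finset.mem_Icc] at hi
    have : ((t - 1 - i : ℕ) : ℤ) = (t : ℤ) - 1 - i := by omega
    rw [this]
    congr 2 <;> ring

theorem sum_range_binomZ_diag_of_lt (s p n : ℕ) (h : p < n) :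
    ∑ r ∈ Finset.range n, binomZ ((s : ℤ) + p - r) ((p : ℤ) - r) = (s + p + 1).choose p := by
  rw [← Finset.sum_subset (Finset.range_subset_range.2 (show p + 1 ≤ n from h)),
    sum_range_binomZ_diag s p (p + 1) le_rfl, if_pos rfl, sub_zero]
  intro r _ hr
  rw [Finset.mem_range] at hr
  exact binomZ_eq_zero (by omega)

/-- The numerator of `cwmapRate`. -/
noncomputable def cwmapNumerator (K t γp : ℕ) : ℝ :=
  (1 + (γp : ℝ)) *
      ((binomZ ((K : ℤ) - t) (1 + γp) : ℝ) +
        ((K : ℝ) - 1) * (binomZ ((K : ℤ) - t - 1) (1 + γp) : ℝ) -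
        ∑ i ∈ Finset.Icc 1 (t - 1),
          (binomZ ((K : ℤ) - t - 1 - ((t : ℤ) - i)) (1 + (γp : ℤ) - ((t : ℤ) - i)) : ℝ))
    - (γp : ℝ) * (K : ℝ) * (binomZ ((K : ℤ) - t - 2) (1 + γp) : ℝ)
    - (if (γp : ℤ) = (t : ℤ) - 1 then cwmapEta K t γp else 0)

theorem le_cwmapNumerator_of_eq {K t p : ℕ} (hpt : p < t) (hK : K = t + (p + 1)) :
    ((p + 1 : ℕ) : ℝ) ≤ cwmapNumerator K t p := by
  have h0 : binomZ ((K : ℤ) - t) (1 + p) = 1 := by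
    have := binomZ_natCast (p + 1) (p + 1)
    rw [Nat.choose_self] at this
    rw [← Nat.cast_one, ← this]
    congr 1 <;> omega
  have h1 : binomZ ((K : ℤ) - t - 1) (1 + p) = 0 := binomZ_eq_zero (by omega)
  have h2 : binomZ ((K : ℤ) - t - 2) (1 + p) = 0 := binomZ_eq_zero (by omega)
  have h3 : ∑ r ∈ Finset.range (t - 1), binomZ ((K : ℤ) - t - 2 - r) ((p : ℤ) - r) = 0 :=
    Finset.sum_eq_zero fun r _ => binomZ_eq_zero (by omega)
  unfold cwmapNumerator
  rw [sum_Icc_binomZ_reflect, h0, h1, h2, h3]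
  have hp : (0 : ℝ) ≤ p := Nat.cast_nonneg p
  split_ifs with h
  · have ht : t = p + 1 := by omega
    subst ht
    have hKR : (K : ℝ) = 2 * (p + 1) := by rw [hK]; push_cast; ring
    have e1 : max 0 (((K : ℝ) - 2 * (p + 1 : ℕ)) * ((K : ℝ) - 2 * (p + 1 : ℕ) + 1) / 2) = 0 :=
      max_eq_left (by rw [hKR]; push_cast; ring_nf; exact le_rfl)
    have e2 : max 0 ((((p + 1 : ℕ) : ℝ) - 1) * ((K : ℝ) - 2 * (p + 1 : ℕ) - 1)) = 0 :=
      max_eq_left (by rw [hKR]; push_cast; ring_nf; linarith)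
    have e3 : max 0 ((K : ℝ) - 2 * (p + 1 : ℕ) - 1) = 0 :=
      max_eq_left (by rw [hKR]; push_cast; ring_nf; norm_num)
    unfold cwmapEta
    rw [e1, e2, e3, hKR]
    push_cast
    nlinarith
  · push_cast
    linarith

theorem binomZ_values {K t p s : ℕ} (hK : K = t + (p + 2 + s)) :
    binomZ ((K : ℤ) - t) (1 + p) = (s + p + 1).choose p + (s + p + 1).choose (p + 1) ∧
      binomZ ((K : ℤ) - t - 1) (1 + p) = (s + p + 1).choose (p + 1) ∧
      binomZ ((K : ℤ) - t - 2) (1 + p) = (s + p).choose (p + 1) := by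
  refine ⟨?_, ?_, ?_⟩
  · rw [← Nat.cast_add, ← Nat.choose_succ_succ, ← binomZ_natCast]
    congr 1 <;> omega
  · rw [← binomZ_natCast]
    congr 1 <;> omega
  · rw [← binomZ_natCast]
    congr 1 <;> omega

theorem choose_le_mul_choose_add_one (p s : ℕ) :
    (s + p + 1).choose p ≤ p * (s + p).choose p + 1 := by
  rcases p with _ | p
  · simp
  have h1 : (s + (p + 1) + 1).choose (p + 1) =
      (s + (p + 1)).choose p + (s + (p + 1)).choose (p + 1) := Nat.choose_succ_succ _ _
  have h2 : (s + (p + 1)).choose (p + 1) * (p + 1) = (s + (p + 1)).choose p * (s + 1) := by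
    rw [Nat.choose_succ_right_eq]
    congr 1
    omega
  rcases s with _ | s
  · have e1 : (0 + (p + 1)).choose p = p + 1 := by
      rw [zero_add, Nat.choose_succ_self_right]
    have e2 : (0 + (p + 1)).choose (p + 1) = 1 := by simp
    rw [h1, e1, e2]
    omega
  rcases p with _ | p
  · rw [h1]; simp; omega
  · rw [h1]
    nlinarith [Nat.zero_le ((s + 1 + (p + 1 + 1)).choose (p + 1) * s),
      Nat.zero_le ((s + 1 + (p + 1 + 1)).choose (p + 1 + 1) * p)]

theorem le_cwmapNumerator_of_lt {K t p s : ℕ} (hpt : p + 1 < t) (hK : K = t + (p + 2 + s)) {n : ℕ}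
    (hn : n + K = K * (p + 2 + s).choose (p + 1)) : (n : ℝ) ≤ cwmapNumerator K t p := by
  obtain ⟨h0, h1, h2⟩ := binomZ_values hK
  have h3 : ∑ r ∈ Finset.range (t - 1), binomZ ((K : ℤ) - t - 2 - r) ((p : ℤ) - r) =
      (s + p + 1).choose p := by
    rw [← sum_range_binomZ_diag_of_lt s p (t - 1) (by omega)]
    refine Finset.sum_congr rfl fun r _ => ?_
    congr 1; omega
  unfold cwmapNumerator
  rw [sum_Icc_binomZ_reflect, h0, h1, h2, h3, if_neg (by omega)]
  have e1 : (p + 2 + s).choose (p + 1) = (s + p + 1).choose p + (s + p + 1).choose (p + 1) := by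
    rw [← Nat.choose_succ_succ]; congr 1; omega
  have e2 : (s + p + 1).choose (p + 1) = (s + p).choose p + (s + p).choose (p + 1) :=
    Nat.choose_succ_succ _ _
  have e3 := choose_le_mul_choose_add_one p s
  rw [e1] at hn
  have hnR : (n : ℝ) + K = K * ((s + p + 1).choose p + (s + p + 1).choose (p + 1)) := by
    exact_mod_cast hn
  have e2R : ((s + p + 1).choose (p + 1) : ℝ) = (s + p).choose p + (s + p).choose (p + 1) := by
    exact_mod_cast e2
  have e3R : ((s + p + 1).choose p : ℝ) ≤ p * (s + p).choose p + 1 := by exact_mod_cast e3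
  have hKnn : (0 : ℝ) ≤ K := Nat.cast_nonneg K
  have := mul_le_mul_of_nonneg_left e3R hKnn
  push_cast
  rw [e2R] at hnR ⊢
  linarith

theorem cwmapEta_eq (p s : ℕ) :
    cwmapEta ((p + 1) + (p + 2 + s)) (p + 1) p =
      ((s : ℝ) + 1) * (2 * p + 2 + s) / 2 := by
  have hp : (0 : ℝ) ≤ p := Nat.cast_nonneg p
  have hs : (0 : ℝ) ≤ s := Nat.cast_nonneg s
  have hd : (((p + 1) + (p + 2 + s) : ℕ) : ℝ) - 2 * ((p + 1 : ℕ) : ℝ) = s + 1 := by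
    push_cast; ring
  have ht : ((p + 1 : ℕ) : ℝ) - 1 = p := by push_cast; ring
  unfold cwmapEta
  rw [hd, ht, max_eq_right (by positivity),
    max_eq_right (by rw [add_sub_cancel_right]; positivity),
    max_eq_right (by rw [add_sub_cancel_right]; positivity)]
  push_cast
  ring

theorem le_cwmapNumerator_of_pairing_all {K p s : ℕ} (hK : K = (p + 1) + (p + 2 + s)) {n : ℕ}
    (hn : 2 * n + K * (s + 2) = 2 * (K * (p + 2 + s).choose (p + 1))) :
    (n : ℝ) ≤ cwmapNumerator K (p + 1) p := by
  obtain ⟨h0, h1, h2⟩ := binomZ_values hK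
  have h3 : ∑ r ∈ Finset.range (p + 1 - 1),
      binomZ ((K : ℤ) - (p + 1 : ℕ) - 2 - r) ((p : ℤ) - r) = (s + p + 1).choose p - 1 := by
    have := sum_range_binomZ_diag s p p (by omega)
    rw [if_neg (by omega), Nat.sub_self, Nat.choose_zero_right, Nat.cast_one] at this
    rw [← this, Nat.add_sub_cancel]
    refine Finset.sum_congr rfl fun r _ => ?_
    congr 1; omega
  have hη : cwmapEta K (p + 1) p = ((s : ℝ) + 1) * (2 * p + 2 + s) / 2 := by
    rw [hK]; exact cwmapEta_eq p s
  unfold cwmapNumerator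
  rw [sum_Icc_binomZ_reflect, h0, h1, h2, h3, if_pos (by push_cast; ring), hη]
  have e1 : (p + 2 + s).choose (p + 1) = (s + p + 1).choose p + (s + p + 1).choose (p + 1) := by
    rw [← Nat.choose_succ_succ]; congr 1; omega
  have e2 : (s + p + 1).choose (p + 1) = (s + p).choose p + (s + p).choose (p + 1) :=
    Nat.choose_succ_succ _ _
  have e3 := choose_le_mul_choose_add_one p s
  rw [e1] at hn
  have hnR : 2 * (n : ℝ) + K * (s + 2) =
      2 * (K * ((s + p + 1).choose p + (s + p + 1).choose (p + 1))) := by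
    exact_mod_cast hn
  have e2R : ((s + p + 1).choose (p + 1) : ℝ) = (s + p).choose p + (s + p).choose (p + 1) := by
    exact_mod_cast e2
  have e3R : ((s + p + 1).choose p : ℝ) ≤ p * (s + p).choose p + 1 := by exact_mod_cast e3
  have hKnn : (0 : ℝ) ≤ K := Nat.cast_nonneg K
  have := mul_le_mul_of_nonneg_left e3R hKnn
  have hKs : (K : ℝ) * s = (2 * p + 3 + s) * s := by rw [hK]; push_cast; ring
  have hKR : (K : ℝ) = 2 * p + 3 + s := by rw [hK]; push_cast; ring
  push_cast
  rw [e2R] at hnR ⊢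
  linarith

theorem cwmapRate_mul {K t p c B : ℕ} (hK : 0 < K) (hp : p ≤ K - t)
    (hB : B = c * (K * (K - t).choose p)) : cwmapRate K t p * B = c * cwmapNumerator K t p := by
  have h1 : (K : ℝ) ≠ 0 := by exact_mod_cast hK.ne'
  have h2 : ((K - t).choose p : ℝ) ≠ 0 := by exact_mod_cast (Nat.choose_pos hp).ne'
  have : cwmapRate K t p = cwmapNumerator K t p / ((K : ℝ) * ((K - t).choose p : ℝ)) := rfl
  rw [this, hB]
  push_cast
  field_simp

theorem exists_isDeliveryCode_le_cwmapNumerator {K t m p : ℕ} [NeZero K] (hK : K = t + m)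
    (hpt : p < t) (hpm : p < m) :
    ∃ (J : Type) (_ : Fintype J)
      (E : (ZMod K → Finset (Fin m) → Fin m → ZMod 2) →+ (J → ZMod 2)),
      IsDeliveryCode K m p E ∧ (Fintype.card J : ℝ) ≤ cwmapNumerator K t p := by
  rcases Nat.exists_eq_add_of_le (show p + 1 ≤ m from hpm) with ⟨_ | s, rfl⟩
  · obtain ⟨E, hE⟩ := exists_isDeliveryCode_of_eq (K := K) (p := p)
    refine ⟨Fin (p + 1), inferInstance, E, hE, ?_⟩
    rw [Fintype.card_fin]
    exact le_cwmapNumerator_of_eq hpt hK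
  have hm : p + 1 + (s + 1) = p + 2 + s := by ring
  rw [hm] at hK ⊢
  rcases Nat.lt_or_ge (p + 1) t with h | h
  · obtain ⟨J, hJ, E, hE, hcard⟩ := exists_isDeliveryCode_saving_card hK hpt (by omega)
    exact ⟨J, hJ, E, hE, le_cwmapNumerator_of_lt h hK hcard⟩
  · obtain rfl : t = p + 1 := by omega
    obtain ⟨J, hJ, E, hE, hcard⟩ := exists_isDeliveryCode_pairing_all hK
    refine ⟨J, hJ, E, hE, le_cwmapNumerator_of_pairing_all hK ?_⟩
    rwa [show p + 2 + s - p = s + 2 by omega] at hcard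

/-- **Achievability (Theorem 2).** Let `N ≥ K ≥ 1`, `L ≥ 1`, `0 ≤ γ_p < γ_a·L`, and
`γ_a·L + γ_p < K`; set `t = γ_a·L`, `M_a = N·γ_a/K`, `M_p = N·γ_p/K`. For every file size
`B` that is a positive multiple of the subpacketization `F = K·C(K−t, γ_p)` there is a
`(K, L, M_a, M_p, N)` CW-MAP caching scheme with uncoded placement whose broadcast length
for every demand vector is at most `R·B`, where `R = cwmapRate K t γ_p` is the rate
expression of the paper. -/
theorem cwmap_achievability
    (K L N γa γp : ℕ) (hK : 1 ≤ K) (hKN : K ≤ N) (hL : 1 ≤ L)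
    (hγp : γp < γa * L) (hsum : γa * L + γp < K)
    (B : ℕ) (hB : 0 < B) (hdvd : K * (K - γa * L).choose γp ∣ B) :
    ∃ C : CWMAPScheme K L N B ((N : ℝ) * γa / K) ((N : ℝ) * γp / K),
      C.Uncoded ∧
        ∀ d : Fin K → Fin N, (C.bLen d : ℝ) ≤ cwmapRate K (γa * L) γp * B := by
  obtain ⟨c, hc⟩ := hdvd
  rw [mul_comm] at hc
  have : NeZero K := ⟨by omega⟩
  have hKm : K = γa * L + (K - γa * L) := by omega
  obtain ⟨J, hJ, E, hE, hcard⟩ :=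
    exists_isDeliveryCode_le_cwmapNumerator hKm hγp (by omega)
  obtain ⟨C, hC, hlen⟩ := CWMAPScheme.exists_of_isDeliveryCode (N := N) hL hKm hK hc E hE
  refine ⟨C, hC, fun d => ?_⟩
  rw [hlen d, cwmapRate_mul hK (by omega) hc, Nat.cast_mul]
  exact mul_le_mul_of_nonneg_left hcard (Nat.cast_nonneg c)
end

section
/- Let K, L, N, γ_a, γ_p be integers with N ≥ K ≥ 1, L ≥ 1, γ_a, γ_p ≥ 0, γ_a·L ≤ K, and set M_a = N·γ_a/K, M_p = N·γ_p/K. If γ_a·L + γ_p = K − 1 (equivalently M_a·L + M_p = N(1 − 1/K)), then the optimal worst-case rate R* of the (K, L, M_a, M_p, N) CW-MAP network equals 1/K: there exists a caching scheme with worst-case rate 1/K, and every caching scheme has worst-case rate at least 1/K. If instead γ_a·L + γ_p ≥ K, then R* = 0. -/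
/-- The bit position `u + t` taken modulo `K`. -/
def cyclicShift {K : ℕ} (u : Fin K) (t : ℕ) : Fin K :=
  ⟨((u : ℕ) + t) % K, Nat.mod_lt _ u.pos⟩

lemma exists_cyclicShift_eq {K : ℕ} (u b : Fin K) : ∃ t < K, cyclicShift u t = b := by
  have hu := u.isLt
  have hb := b.isLt
  rcases le_or_gt (u : ℕ) b with h | h
  · refine ⟨b - u, by omega, Fin.ext ?_⟩
    have : (u : ℕ) + (b - u) = b := by omega
    simp only [cyclicShift, this, Nat.mod_eq_of_lt hb]
  · refine ⟨b + K - u, by omega, Fin.ext ?_⟩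
    have : (u : ℕ) + (b + K - u) = b + K := by omega
    simp only [cyclicShift, this, Nat.add_mod_right, Nat.mod_eq_of_lt hb]

lemma cyclicShift_left_injective {K : ℕ} (t : ℕ) :
    Function.Injective fun u : Fin K => cyclicShift u t := by
  intro u v h
  have h' : (u : ℕ) + t ≡ v + t [MOD K] := congrArg Fin.val h
  exact Fin.ext (Nat.ModEq.eq_of_lt_of_lt (Nat.ModEq.add_right_cancel' t h') u.isLt v.isLt)

/-- With one bit per subfile and `K` subfiles, the caches can be filled so that user `u` has
access to the `γa * L + γp` cyclically consecutive subfiles of every file that start at `u`.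
Any broadcast that together with these determines the demanded file gives a scheme. -/
lemma exists_scheme_of_broadcast {K L N : ℕ} (γa γp m : ℕ) (hK : 0 < K)
    (bEnc : (Fin K → Fin N) → (Fin N → Fin K → Bool) → (Fin m → Bool))
    (hdet : ∀ (u : Fin K) (d : Fin K → Fin N) (W W' : Fin N → Fin K → Bool),
      bEnc d W = bEnc d W' →
      (∀ n, ∀ t < γa * L + γp, W n (cyclicShift u t) = W' n (cyclicShift u t)) →
      W (d u) = W' (d u)) :
    ∃ C : CWMAPScheme K L N K ((N : ℝ) * γa / K) ((N : ℝ) * γp / K), ∀ d, C.bLen d = m := by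
  have hK' : (K : ℝ) ≠ 0 := by positivity
  let aPlace : Fin K → (Fin N → Fin K → Bool) → (Fin (N * γa) → Bool) := fun k W i =>
    W (finProdFinEquiv.symm i).1 (cyclicShift k (L * (finProdFinEquiv.symm i).2))
  let pPlace : Fin K → (Fin N → Fin K → Bool) → (Fin (N * γp) → Bool) := fun u W i =>
    W (finProdFinEquiv.symm i).1 (cyclicShift u (γa * L + (finProdFinEquiv.symm i).2))
  let view : (u : Fin K) → (Fin K → Fin N) → (Fin N → Fin K → Bool) →
      (Fin m → Bool) × (Fin L → Fin (N * γa) → Bool) × (Fin (N * γp) → Bool) :=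
    fun u d W => (bEnc d W, fun j => aPlace (cyclicShift u j) W, pPlace u W)
  have hfac : ∀ u d, Function.FactorsThrough (fun W : Fin N → Fin K → Bool => W (d u))
      (view u d) := by
    intro u d W W' h
    simp only [view, Prod.mk.injEq] at h
    obtain ⟨hb, ha, hp⟩ := h
    refine hdet u d W W' hb fun n t ht => ?_
    rcases lt_or_ge t (γa * L) with hlt | hge
    · have hL : 0 < L := Nat.pos_of_mul_pos_left (lt_of_le_of_lt (Nat.zero_le _) hlt)
      have hq : t / L < γa := (Nat.div_lt_iff_lt_mul hL).2 hlt
      have h1 := congrFun (congrFun ha ⟨t % L, Nat.mod_lt _ hL⟩) (finProdFinEquiv (n, ⟨t / L, hq⟩))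
      have h2 : cyclicShift (cyclicShift u (t % L)) (L * (t / L)) = cyclicShift u t := by
        apply Fin.ext
        simp only [cyclicShift, Nat.mod_add_mod, add_assoc, Nat.mod_add_div]
      simpa only [aPlace, Equiv.symm_apply_apply, h2] using h1
    · have h1 := congrFun hp (finProdFinEquiv (n, ⟨t - γa * L, by omega⟩))
      simpa only [pPlace, Equiv.symm_apply_apply, Nat.add_sub_cancel' hge] using h1
  exact ⟨{
    hK := hK
    aLen := fun _ => N * γa
    aLen_le := fun _ => by rw [div_mul_cancel₀ _ hK']; push_cast; exact le_rfl
    aPlace := aPlace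
    pLen := fun _ => N * γp
    pLen_le := fun _ => by rw [div_mul_cancel₀ _ hK']; push_cast; exact le_rfl
    pPlace := pPlace
    bLen := fun _ => m
    bEnc := bEnc
    decode := fun u d x a p =>
      Function.extend (view u d) (fun W => W (d u)) (fun _ _ => false) (x, a, p)
    decode_correct := fun u d W => (hfac u d).extend_apply _ W }, fun _ => rfl⟩

/-- If each user misses only one subfile, broadcasting the parity of the missing subfiles of the
demanded files suffices. -/
lemma exists_scheme_bLen_eq_one {K L N γa γp : ℕ} (hK : 0 < K) (h : γa * L + γp = K - 1) :
    ∃ C : CWMAPScheme K L N K ((N : ℝ) * γa / K) ((N : ℝ) * γp / K), ∀ d, C.bLen d = 1 := by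
  refine exists_scheme_of_broadcast γa γp 1 hK
    (fun d W _ => decide (Even (∑ v, (W (d v) (cyclicShift v (K - 1))).toNat))) ?_
  intro u d W W' hb hc
  rw [h] at hc
  have hoff : ∀ n b, b ≠ cyclicShift u (K - 1) → W n b = W' n b := by
    intro n b hne
    obtain ⟨t, ht, rfl⟩ := exists_cyclicShift_eq u b
    have : t ≠ K - 1 := by rintro rfl; exact hne rfl
    exact hc n t (by omega)
  have hrest : ∑ v ∈ Finset.univ.erase u, (W (d v) (cyclicShift v (K - 1))).toNat =
      ∑ v ∈ Finset.univ.erase u, (W' (d v) (cyclicShift v (K - 1))).toNat := by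
    refine Finset.sum_congr rfl fun v hv => ?_
    rw [hoff _ _ fun e => Finset.ne_of_mem_erase hv (cyclicShift_left_injective _ e)]
  have hpar := congrFun hb 0
  simp only [decide_eq_decide, ← Finset.add_sum_erase _ _ (Finset.mem_univ u), hrest,
    Nat.even_add] at hpar
  have hmiss : W (d u) (cyclicShift u (K - 1)) = W' (d u) (cyclicShift u (K - 1)) := by
    revert hpar
    cases W (d u) (cyclicShift u (K - 1)) <;> cases W' (d u) (cyclicShift u (K - 1)) <;>
      simp [-Nat.not_even_iff_odd]
  funext b
  by_cases hbu : b = cyclicShift u (K - 1)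
  · rw [hbu, hmiss]
  · exact hoff _ _ hbu

lemma exists_scheme_bLen_eq_zero {K L N γa γp : ℕ} (hK : 0 < K) (h : K ≤ γa * L + γp) :
    ∃ C : CWMAPScheme K L N K ((N : ℝ) * γa / K) ((N : ℝ) * γp / K), ∀ d, C.bLen d = 0 := by
  refine exists_scheme_of_broadcast γa γp 0 hK (fun _ _ _ => false) ?_
  intro u d W W' _ hc
  funext b
  obtain ⟨t, ht, rfl⟩ := exists_cyclicShift_eq u b
  exact hc _ t (by omega)

/-- Cut-set bound for a single user: the broadcasts for the `N` constant demand vectors and the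
caches available to user `u` determine all `N` files. -/
lemma CWMAPScheme.cutset {K L N B : ℕ} {Ma Mp : ℝ} (C : CWMAPScheme K L N B Ma Mp) (u : Fin K) :
    N * B ≤ ∑ n : Fin N, C.bLen (fun _ => n) +
      (∑ j : Fin L, C.aLen ⟨((u : ℕ) + (j : ℕ)) % K, Nat.mod_lt _ C.hK⟩ + C.pLen u) := by
  let view : (Fin N → Fin B → Bool) →
      ((n : Fin N) → Fin (C.bLen fun _ => n) → Bool) ×
      ((j : Fin L) → Fin (C.aLen ⟨((u : ℕ) + (j : ℕ)) % K, Nat.mod_lt _ C.hK⟩) → Bool) ×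
      (Fin (C.pLen u) → Bool) :=
    fun W => (fun n => C.bEnc _ W, fun j => C.aPlace _ W, C.pPlace u W)
  have hinj : Function.Injective view := by
    intro W W' h
    simp only [view, Prod.mk.injEq] at h
    obtain ⟨hb, ha, hp⟩ := h
    funext n
    have h1 := C.decode_correct u (fun _ => n) W
    have h2 := C.decode_correct u (fun _ => n) W'
    rw [← h1, ← h2, ha, hp, show C.bEnc (fun _ => n) W = C.bEnc (fun _ => n) W' from congrFun hb n]
  have hcard := Fintype.card_le_of_injective view hinj
  simp only [Fintype.card_pi, Fintype.card_prod, Fintype.card_bool, Finset.prod_const,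
    Finset.card_univ, Fintype.card_fin, Finset.prod_pow_eq_pow_sum, ← pow_add, ← pow_mul] at hcard
  rw [mul_comm]
  exact (Nat.pow_le_pow_iff_right (by norm_num)).1 hcard

lemma CWMAPScheme.rateLE.cutset {K L N B : ℕ} {Ma Mp R : ℝ} {C : CWMAPScheme K L N B Ma Mp}
    (hB : 0 < B) (hR : C.rateLE R) : (N : ℝ) ≤ N * R + (L * Ma + Mp) := by
  have hcut : ((N * B : ℕ) : ℝ) ≤ _ := Nat.cast_le.2 (C.cutset ⟨0, C.hK⟩)
  push_cast at hcut
  have h1 : ∑ n : Fin N, (C.bLen (fun _ => n) : ℝ) ≤ N * (R * B) :=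
    (Finset.sum_le_sum fun n _ => hR _).trans_eq (by simp)
  have h2 : ∑ j : Fin L, (C.aLen ⟨(0 + (j : ℕ)) % K, Nat.mod_lt _ C.hK⟩ : ℝ) ≤ L * (Ma * B) :=
    (Finset.sum_le_sum fun j _ => C.aLen_le _).trans_eq (by simp)
  have h3 := C.pLen_le ⟨0, C.hK⟩
  have hB' : (0 : ℝ) < B := by exact_mod_cast hB
  refine le_of_mul_le_mul_right ?_ hB'
  linarith

/-- **Optimality in the large memory regime (Lemma 1).**
Let `N ≥ K ≥ 1`, `L ≥ 1`, `γ_a·L ≤ K`, and set `M_a = N·γ_a/K`, `M_p = N·γ_p/K`.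
If `γ_a·L + γ_p = K − 1` (i.e. `M_a·L + M_p = N(1 − 1/K)`), then the optimal worst-case
rate is `1/K`: some scheme achieves worst-case rate `1/K`, and every scheme has worst-case
rate at least `1/K`. If instead `γ_a·L + γ_p ≥ K`, the optimal worst-case rate is `0`:
some scheme makes no transmissions at all, and every scheme has worst-case rate at least `0`. -/
theorem cwmap_large_memory_optimality
    (K L N γa γp : ℕ) (hK : 1 ≤ K) (hKN : K ≤ N) (hL : 1 ≤ L) (hγa : γa * L ≤ K) :
    (γa * L + γp = K - 1 →
      ((∃ B : ℕ, 1 ≤ B ∧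
          ∃ C : CWMAPScheme K L N B ((N : ℝ) * γa / K) ((N : ℝ) * γp / K),
            C.rateLE ((1 : ℝ) / K)) ∧
        (∀ B : ℕ, 1 ≤ B →
          ∀ C : CWMAPScheme K L N B ((N : ℝ) * γa / K) ((N : ℝ) * γp / K),
            ∀ R : ℝ, C.rateLE R → (1 : ℝ) / K ≤ R))) ∧
    (K ≤ γa * L + γp →
      ((∃ B : ℕ, 1 ≤ B ∧
          ∃ C : CWMAPScheme K L N B ((N : ℝ) * γa / K) ((N : ℝ) * γp / K),
            ∀ d : Fin K → Fin N, C.bLen d = 0) ∧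
        (∀ B : ℕ, 1 ≤ B →
          ∀ C : CWMAPScheme K L N B ((N : ℝ) * γa / K) ((N : ℝ) * γp / K),
            ∀ R : ℝ, C.rateLE R → (0 : ℝ) ≤ R))) := by
  have hKR : (0 : ℝ) < K := by exact_mod_cast hK
  have hNR : (0 : ℝ) < N := by exact_mod_cast hK.trans hKN
  refine ⟨fun h => ⟨?_, fun B hB C R hR => ?_⟩, fun h => ⟨?_, fun B hB C R hR => ?_⟩⟩
  · obtain ⟨C, hC⟩ := exists_scheme_bLen_eq_one (N := N) hK h
    refine ⟨K, hK, C, fun d => ?_⟩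
    rw [hC, div_mul_cancel₀ _ hKR.ne', Nat.cast_one]
  · have hcut := hR.cutset hB
    have hsum : (γa : ℝ) * L + γp + 1 = K := by
      exact_mod_cast (show γa * L + γp + 1 = K by omega)
    have hmem : (L : ℝ) * (N * γa / K) + N * γp / K = N * (1 - 1 / K) := by
      rw [← hsum] at hKR ⊢
      field_simp
      ring
    rw [hmem, ← mul_add] at hcut
    have := le_of_mul_le_mul_left ((mul_one (N : ℝ)).trans_le hcut) hNR
    linarith
  · exact ⟨K, hK, exists_scheme_bLen_eq_zero hK h⟩
  · have hd := hR fun _ => ⟨0, hK.trans hKN⟩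
    exact nonneg_of_mul_nonneg_left ((Nat.cast_nonneg _).trans hd) (by exact_mod_cast hB)
end

section
/- Let K, t, γ_p be integers with t ≥ 2, 0 ≤ γ_p ≤ t−2, and t + γ_p + 1 ≤ K. Then the number of subsets I of ZMod K with |I| = 1 + t + γ_p that contain exactly one cyclic interval of length t equals K·C(K−t−2, 1+γ_p), where C(n,k) denotes the binomial coefficient with the convention C(n,k) = 0 whenever n < 0, k < 0, or n < k. -/
/-- The cyclic interval `{i, i+1, ..., i+m−1}` (addition modulo `K`) in `ZMod K`. -/
def cycInterval (K m : ℕ) (i : ZMod K) : Finset (ZMod K) :=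
  (Finset.range m).image (fun j : ℕ => (i + (j : ZMod K)))

/-- `S` is a cyclic interval of length `m` in `ZMod K`. -/
def IsCycInterval (K m : ℕ) (S : Finset (ZMod K)) : Prop :=
  ∃ i : ZMod K, S = cycInterval K m i

theorem mem_cycInterval {K m : ℕ} {i x : ZMod K} :
    x ∈ cycInterval K m i ↔ ∃ j < m, i + (j : ZMod K) = x := by
  simp [cycInterval]

theorem natCast_zmod_inj_of_lt {K a b : ℕ} (ha : a < K) (hb : b < K)
    (h : (a : ZMod K) = b) : a = b := by
  rw [ZMod.natCast_eq_natCast_iff] at h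
  exact Nat.ModEq.eq_of_lt_of_lt h ha hb

theorem card_cycInterval {K m : ℕ} (h : m ≤ K) (i : ZMod K) : (cycInterval K m i).card = m := by
  rw [cycInterval, Finset.card_image_of_injOn, Finset.card_range]
  intro a ha b hb hab
  simp only [Finset.coe_range, Set.mem_Iio] at ha hb
  exact natCast_zmod_inj_of_lt (by omega) (by omega) (add_left_cancel hab)

theorem add_natCast_notMem_cycInterval {K m : ℕ} (h : m < K) (i : ZMod K) :
    i + (m : ZMod K) ∉ cycInterval K m i := by
  rw [mem_cycInterval]
  rintro ⟨j, hj, hij⟩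
  have := natCast_zmod_inj_of_lt (by omega) h (add_left_cancel hij)
  omega

theorem sub_one_notMem_cycInterval {K m : ℕ} (h : m < K) (i : ZMod K) :
    i - 1 ∉ cycInterval K m i := by
  rw [mem_cycInterval]
  rintro ⟨j, hj, hij⟩
  have h0 : ((j + 1 : ℕ) : ZMod K) = (0 : ℕ) := by
    push_cast
    linear_combination hij
  have := natCast_zmod_inj_of_lt (by omega) (by omega) h0
  omega

/-- A maximal run of length `m` in a set with fewer than `2 * m` elements is the only cyclic
interval of length `m` in that set. -/
theorem eq_of_cycInterval_subset {K m : ℕ} [NeZero K] {I : Finset (ZMod K)}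
    {i j : ZMod K} (hm : m ≤ K) (hI : I.card < 2 * m) (hi : cycInterval K m i ⊆ I)
    (hl : i - 1 ∉ I) (hr : i + (m : ZMod K) ∉ I) (hj : cycInterval K m j ⊆ I) : j = i := by
  obtain ⟨d, hdK, rfl⟩ : ∃ d < K, j = i + (d : ZMod K) :=
    ⟨(j - i).val, ZMod.val_lt _, by simp⟩
  rcases Nat.eq_zero_or_pos d with rfl | hd
  · simp
  exfalso
  by_cases hdm : d ≤ m
  · refine hr (hj (mem_cycInterval.2 ⟨m - d, by omega, ?_⟩))
    rw [Nat.cast_sub hdm]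
    ring
  by_cases hdK' : K ≤ d + m
  · refine hl (hj (mem_cycInterval.2 ⟨K - (d + 1), by omega, ?_⟩))
    rw [Nat.cast_sub (by omega), ZMod.natCast_self]
    push_cast
    ring
  have hdis : Disjoint (cycInterval K m i) (cycInterval K m (i + d)) := by
    rw [Finset.disjoint_left]
    intro x hx hx'
    obtain ⟨a, ha, rfl⟩ := mem_cycInterval.1 hx
    obtain ⟨b, hb, hab⟩ := mem_cycInterval.1 hx'
    have h : ((d + b : ℕ) : ZMod K) = (a : ℕ) := by
      push_cast
      linear_combination hab
    have := natCast_zmod_inj_of_lt (by omega) (by omega) h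
    omega
  have := Finset.card_le_card (Finset.union_subset hi hj)
  rw [Finset.card_union_of_disjoint hdis, card_cycInterval hm, card_cycInterval hm] at this
  omega

/-- A set with fewer than `2 * m` elements contains exactly one cyclic interval of length `m` iff
it contains such an interval that cannot be extended on either side. -/
theorem existsUnique_isCycInterval_iff {K m : ℕ} [NeZero K] {I : Finset (ZMod K)}
    (hm : m < K) (hI : I.card < 2 * m) :
    (∃! S : Finset (ZMod K), S ⊆ I ∧ IsCycInterval K m S) ↔
      ∃ i, cycInterval K m i ⊆ I ∧ i - 1 ∉ I ∧ i + (m : ZMod K) ∉ I := by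
  constructor
  · rintro ⟨_, ⟨hS, i, rfl⟩, huniq⟩
    refine ⟨i, hS, fun hl => ?_, fun hr => ?_⟩
    · have hsub : cycInterval K m (i - 1) ⊆ I := by
        intro x hx
        obtain ⟨j, hj, rfl⟩ := mem_cycInterval.1 hx
        rcases j with _ | j
        · simpa using hl
        · exact hS (mem_cycInterval.2 ⟨j, by omega, by push_cast; ring⟩)
      have heq := huniq _ ⟨hsub, _, rfl⟩
      refine sub_one_notMem_cycInterval hm i (heq ▸ ?_)
      exact mem_cycInterval.2 ⟨0, by omega, by simp⟩
    · have hsub : cycInterval K m (i + 1) ⊆ I := by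
        intro x hx
        obtain ⟨j, hj, rfl⟩ := mem_cycInterval.1 hx
        have hx' : i + 1 + (j : ZMod K) = i + ((j + 1 : ℕ) : ZMod K) := by push_cast; ring
        rw [hx']
        rcases Nat.lt_or_ge (j + 1) m with h | h
        · exact hS (mem_cycInterval.2 ⟨j + 1, h, rfl⟩)
        · rwa [show j + 1 = m by omega]
      have heq := huniq _ ⟨hsub, _, rfl⟩
      refine add_natCast_notMem_cycInterval hm i (heq ▸ ?_)
      refine mem_cycInterval.2 ⟨m - 1, by omega, ?_⟩
      rw [Nat.cast_sub (by omega)]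
      push_cast
      ring
  · rintro ⟨i, hi, hl, hr⟩
    refine ⟨_, ⟨hi, i, rfl⟩, ?_⟩
    rintro _ ⟨hS, j, rfl⟩
    rw [eq_of_cycInterval_subset hm.le hI hi hl hr hS]

/-- The supersets of `C` of cardinality `C.card + k` avoiding `D`. -/
theorem card_filter_superset_disjoint {α : Type*} [Fintype α] [DecidableEq α]
    (C D : Finset α) (hCD : Disjoint C D) (k : ℕ) :
    (Finset.univ.filter fun I : Finset α =>
      I.card = C.card + k ∧ C ⊆ I ∧ Disjoint I D).card =
      (Fintype.card α - (C.card + D.card)).choose k := by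
  rw [← Finset.card_union_of_disjoint hCD, ← Finset.card_compl, ← Finset.card_powersetCard]
  refine Finset.card_nbij' (· \ C) (· ∪ C) ?_ ?_ ?_ ?_
  · intro I hI
    simp only [Finset.coe_filter, Finset.mem_univ, true_and, Set.mem_ofPred_eq] at hI
    obtain ⟨hc, hC, hD⟩ := hI
    simp only [Finset.mem_coe, Finset.mem_powersetCard]
    refine ⟨fun x hx => ?_, ?_⟩
    · rw [Finset.mem_sdiff] at hx
      simp [hx.2, Finset.disjoint_left.1 hD hx.1]
    · rw [Finset.card_sdiff_of_subset hC]
      omega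
  · intro J hJ
    simp only [Finset.mem_coe, Finset.mem_powersetCard] at hJ
    obtain ⟨hJ, hc⟩ := hJ
    have hJ' := Finset.disjoint_union_right.1 (Finset.subset_compl_iff_disjoint_right.1 hJ)
    simp only [Finset.coe_filter, Finset.mem_univ, true_and, Set.mem_ofPred_eq]
    refine ⟨?_, Finset.subset_union_right, Finset.disjoint_union_left.2 ⟨hJ'.2, hCD⟩⟩
    rw [Finset.card_union_of_disjoint hJ'.1]
    omega
  · intro I hI
    simp only [Finset.coe_filter, Finset.mem_univ, true_and, Set.mem_ofPred_eq] at hI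
    exact Finset.sdiff_union_of_subset hI.2.1
  · intro J hJ
    simp only [Finset.mem_coe, Finset.mem_powersetCard] at hJ
    have hJ' := Finset.disjoint_union_right.1 (Finset.subset_compl_iff_disjoint_right.1 hJ.1)
    exact Finset.union_sdiff_cancel_right hJ'.1

/-- The number of `(m + k)`-element subsets of `ZMod K` in which `i, ..., i + m - 1` is a maximal
run. -/
theorem card_filter_maximal_cycInterval {K m k : ℕ} [NeZero K] (hm : m < K) (hk : 0 < k)
    (i : ZMod K) :
    ((Finset.univ.filter fun I : Finset (ZMod K) => I.card = m + k ∧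
      cycInterval K m i ⊆ I ∧ i - 1 ∉ I ∧ i + (m : ZMod K) ∉ I).card : ℤ) =
      binomZ ((K : ℤ) - m - 2) k := by
  have hcard := card_filter_superset_disjoint (cycInterval K m i) {i - 1, i + (m : ZMod K)}
    (by simp [sub_one_notMem_cycInterval hm, add_natCast_notMem_cycInterval hm]) k
  simp only [card_cycInterval hm.le, Finset.disjoint_insert_right, Finset.disjoint_singleton_right,
    ZMod.card] at hcard
  rw [hcard]
  rcases Nat.lt_or_ge K (m + 2) with h | h
  · have hpos : 0 < ({i - 1, i + (m : ZMod K)} : Finset (ZMod K)).card :=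
      Finset.card_pos.2 (Finset.insert_nonempty _ _)
    rw [Nat.choose_eq_zero_of_lt (by omega), binomZ, if_neg (by omega), Nat.cast_zero]
  · have hne : i - 1 ≠ i + (m : ZMod K) := by
      intro hne
      have h0 : ((m + 1 : ℕ) : ZMod K) = (0 : ℕ) := by
        push_cast
        linear_combination -hne
      have := natCast_zmod_inj_of_lt (by omega) (by omega) h0
      omega
    rw [Finset.card_pair hne, ← binomZ_natCast]
    congr 1
    omega

/-- **Number of Special Case 1 transmission-subsets, regime `γ_p ≤ t − 2`.**
For `t ≥ 2`, `0 ≤ γ_p ≤ t−2`, `t + γ_p + 1 ≤ K`, the number of subsets `I` of `ZMod K`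
with `|I| = 1 + t + γ_p` containing exactly one cyclic interval of length `t` equals
`K·C(K−t−2, 1+γ_p)`. -/
theorem count_special_case_one_subsets
    (K t γp : ℕ) (ht : 2 ≤ t) (hγp : γp ≤ t - 2) (hK : t + γp + 1 ≤ K) :
    ({I : Finset (ZMod K) | I.card = 1 + t + γp ∧
        ∃! S : Finset (ZMod K), S ⊆ I ∧ IsCycInterval K t S}.ncard : ℤ) =
      (K : ℤ) * binomZ ((K : ℤ) - t - 2) (1 + γp) := by
  have : NeZero K := ⟨by omega⟩
  have hset : {I : Finset (ZMod K) | I.card = 1 + t + γp ∧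
      ∃! S : Finset (ZMod K), S ⊆ I ∧ IsCycInterval K t S} =
      ((Finset.univ.biUnion fun i : ZMod K => Finset.univ.filter fun I : Finset (ZMod K) =>
        I.card = t + (1 + γp) ∧ cycInterval K t i ⊆ I ∧ i - 1 ∉ I ∧ i + (t : ZMod K) ∉ I :
        Finset (Finset (ZMod K))) : Set (Finset (ZMod K))) := by
    ext I
    simp only [Set.mem_ofPred_eq, Finset.mem_coe, Finset.mem_biUnion, Finset.mem_univ, true_and,
      Finset.mem_filter, exists_and_left]
    rw [show 1 + t + γp = t + (1 + γp) by ring]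
    exact and_congr_right fun hI => existsUnique_isCycInterval_iff (by omega) (by omega)
  rw [hset, Set.ncard_coe_finset, Finset.card_biUnion]
  · rw [Nat.cast_sum, Finset.sum_congr rfl fun i _ =>
      card_filter_maximal_cycInterval (by omega) (by omega) i]
    simp [ZMod.card]
  · intro i _ j _ hij
    refine Finset.disjoint_left.2 fun I hIi hIj => ?_
    simp only [Finset.mem_filter, Finset.mem_univ, true_and] at hIi hIj
    obtain ⟨hc, hi, hl, hr⟩ := hIi
    exact hij (eq_of_cycInterval_subset (by omega) (by omega) hi hl hr hIj.2.1).symm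
end

section
/- Let K, t, n be integers with 1 ≤ t < K and t ≤ n ≤ K. Let I ⊆ {0, 1, ..., K−1} with |I| = n, and list the elements of I in increasing order as e_1 < e_2 < ... < e_n. Suppose S ⊆ I is, when its elements are viewed as residues, a cyclic interval of length t in ZMod K. Then the position set P = {j ∈ {1,...,n} : e_j ∈ S} is a cyclic interval of length t in ZMod n, i.e., P = {j_0, j_0+1, ..., j_0+t−1} with addition modulo n for some j_0. (This justifies the delivery algorithm's generation of all subfile-index sets inside a union set I by cyclically shifting the subfile-index-position set.) -/
theorem mem_cycInterval_natCast_iff {n t p : ℕ} [NeZero n] (hp : p ≤ n) (x : ZMod n) :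
    x ∈ cycInterval n t p ↔ p ≤ x.val ∧ x.val < p + t ∨ x.val + n < p + t := by
  have hx := x.val_lt
  simp only [cycInterval, Finset.mem_image, Finset.mem_range]
  constructor
  · rintro ⟨j, hj, rfl⟩
    rw [← Nat.cast_add, ZMod.val_natCast] at hx ⊢
    rcases lt_or_ge (p + j) n with h | h
    · rw [Nat.mod_eq_of_lt h]
      omega
    · rcases lt_or_ge (p + j - n) n with h' | h'
      · rw [Nat.mod_eq_sub_mod h, Nat.mod_eq_of_lt h']
        omega
      · omega
  · rintro (h | h)
    · refine ⟨x.val - p, by omega, ?_⟩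
      rw [← Nat.cast_add, Nat.add_sub_cancel' h.1, ZMod.natCast_zmod_val]
    · refine ⟨x.val + n - p, by omega, ?_⟩
      rw [← Nat.cast_add, Nat.add_sub_cancel' (by omega), Nat.cast_add, ZMod.natCast_self,
        add_zero, ZMod.natCast_zmod_val]

theorem card_cycInterval_s12 {n t : ℕ} (ht : t ≤ n) (i : ZMod n) : (cycInterval n t i).card = t := by
  rw [cycInterval, Finset.card_image_of_injOn, Finset.card_range]
  intro a ha b hb h
  simp only [Finset.coe_range, Set.mem_Iio] at ha hb
  have h' := add_left_cancel h
  rw [ZMod.natCast_eq_natCast_iff'] at h'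
  rwa [Nat.mod_eq_of_lt (by omega), Nat.mod_eq_of_lt (by omega)] at h'

/-- The indices at which a monotone function on `Fin n` lies below a bound form an initial
segment. -/
theorem Monotone.exists_lt_iff_val_lt {n : ℕ} {α : Type*} [LinearOrder α] {f : Fin n → α}
    (hf : Monotone f) (x : α) : ∃ r ≤ n, ∀ j : Fin n, f j < x ↔ (j : ℕ) < r := by
  classical
  have hex : ∃ r, ∀ j : Fin n, r ≤ (j : ℕ) → x ≤ f j := ⟨n, fun j hj => by omega⟩
  refine ⟨Nat.find hex, Nat.find_min' hex fun j hj => by omega, fun j =>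
    ⟨fun hj => ?_, fun hj => ?_⟩⟩
  · by_contra! h
    exact (Nat.find_spec hex j h).not_gt hj
  · have := Nat.find_min hex hj
    push Not at this
    obtain ⟨k, hk, hkx⟩ := this
    exact (hf (Fin.le_def.2 hk)).trans_lt hkx

/-- Positions in `Fin n` lying in `[p, p + t)` up to wrapping around `n` form a cyclic
interval. -/
theorem isCycInterval_image_of_mem_iff {n t p : ℕ} (hp : p ≤ n) (ht : t ≤ n)
    {P : Finset (Fin n)}
    (hP : ∀ j : Fin n, j ∈ P ↔ p ≤ (j : ℕ) ∧ (j : ℕ) < p + t ∨ (j : ℕ) + n < p + t) :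
    IsCycInterval n t (P.image fun j : Fin n => ((j : ℕ) : ZMod n)) := by
  refine ⟨p, ?_⟩
  rcases Nat.eq_zero_or_pos n with rfl | hn
  · obtain rfl : t = 0 := by omega
    simp [cycInterval, Finset.eq_empty_of_isEmpty P]
  have : NeZero n := ⟨hn.ne'⟩
  ext x
  rw [mem_cycInterval_natCast_iff hp, Finset.mem_image]
  constructor
  · rintro ⟨j, hj, rfl⟩
    rw [ZMod.val_natCast_of_lt j.isLt]
    exact (hP j).1 hj
  · intro h
    exact ⟨⟨x.val, x.val_lt⟩, (hP _).2 h, ZMod.natCast_zmod_val x⟩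

/-- **Position sets of subfile-index sets are cyclic intervals.**
Let `1 ≤ t < K`, `t ≤ n ≤ K`, let `I ⊆ {0, ..., K−1}` with `|I| = n`, listed in increasing
order by the order embedding `e : Fin n ↪o ℕ`, and let `S ⊆ I` be such that, viewed as
residues, `S` is a cyclic interval of length `t` in `ZMod K`. Then the position set
`P = {j : e j ∈ S}`, viewed in `ZMod n`, is a cyclic interval of length `t` in `ZMod n`. -/
theorem position_set_isCycInterval
    (K t n : ℕ) (ht : 1 ≤ t) (htK : t < K) (htn : t ≤ n) (hnK : n ≤ K)
    (I : Finset ℕ) (hI : ∀ x ∈ I, x < K) (hcard : I.card = n)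
    (S : Finset ℕ) (hS : S ⊆ I)
    (hScyc : IsCycInterval K t (S.image (fun x : ℕ => (x : ZMod K)))) :
    IsCycInterval n t
      ((Finset.univ.filter (fun j : Fin n => I.orderEmbOfFin hcard j ∈ S)).image
        (fun j : Fin n => ((j : ℕ) : ZMod n))) := by
  have : NeZero K := ⟨by omega⟩
  obtain ⟨i, hi⟩ := hScyc
  have hia := i.val_lt
  have hSK : ∀ x ∈ S, x < K := fun x hx => hI x (hS hx)
  have hinj : Set.InjOn (fun x : ℕ => (x : ZMod K)) S := by
    intro x hx y hy h
    have h' := congrArg ZMod.val h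
    rwa [ZMod.val_natCast_of_lt (hSK x hx), ZMod.val_natCast_of_lt (hSK y hy)] at h'
  have hScard : S.card = t := by
    rw [← Finset.card_image_of_injOn hinj, hi, card_cycInterval_s12 htK.le]
  have hmem : ∀ x < K, x ∈ S ↔ i.val ≤ x ∧ x < i.val + t ∨ x + K < i.val + t := by
    intro x hx
    have h := mem_cycInterval_natCast_iff (t := t) hia.le (x : ZMod K)
    rw [ZMod.natCast_zmod_val, ZMod.val_natCast_of_lt hx, ← hi, Finset.mem_image] at h
    rw [← h]
    refine ⟨fun hxS => ⟨x, hxS, rfl⟩, ?_⟩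
    rintro ⟨y, hy, hyx⟩
    have h' := congrArg ZMod.val hyx
    rw [ZMod.val_natCast_of_lt (hSK y hy), ZMod.val_natCast_of_lt hx] at h'
    exact h' ▸ hy
  set e := I.orderEmbOfFin hcard with he
  have heK : ∀ j, e j < K := fun j => hI _ (I.orderEmbOfFin_mem hcard j)
  set P : Finset (Fin n) := Finset.univ.filter fun j => e j ∈ S with hPdef
  have hPS : P.map e.toEmbedding = S := by
    ext x
    simp only [hPdef, Finset.mem_map, Finset.mem_filter, Finset.mem_univ, true_and]
    constructor
    · rintro ⟨j, hj, rfl⟩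
      exact hj
    · intro hx
      have hxI : x ∈ Set.range e := by
        rw [he, Finset.range_orderEmbOfFin]
        exact hS hx
      obtain ⟨j, rfl⟩ := hxI
      exact ⟨j, hx, rfl⟩
  have hPcard : (P.map Fin.valEmbedding).card = t := by
    rw [Finset.card_map, ← hScard, ← hPS, Finset.card_map]
  have hPmem : ∀ j, j ∈ P ↔ i.val ≤ e j ∧ e j < i.val + t ∨ e j + K < i.val + t := fun j => by
    rw [← hmem _ (heK j)]
    simp [hPdef]
  obtain ⟨p, hp, hpe⟩ := e.monotone.exists_lt_iff_val_lt i.val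
  rcases le_or_gt (i.val + t) K with hw | hw
  · obtain ⟨q, hq, hqe⟩ := e.monotone.exists_lt_iff_val_lt (i.val + t)
    have hPpq : ∀ j, j ∈ P ↔ p ≤ (j : ℕ) ∧ (j : ℕ) < q := fun j => by
      rw [hPmem, ← hqe, ← not_lt, ← not_lt, hpe]
      omega
    have hP : P.map Fin.valEmbedding = Finset.Ico p q := by
      ext x
      simp only [Finset.mem_map, Fin.valEmbedding_apply, Finset.mem_Ico, hPpq]
      exact ⟨by rintro ⟨j, hj, rfl⟩; exact hj, fun h => ⟨⟨x, by omega⟩, h, rfl⟩⟩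
    rw [hP, Nat.card_Ico] at hPcard
    refine isCycInterval_image_of_mem_iff hp htn fun j => ?_
    rw [hPpq]
    omega
  · obtain ⟨q, hq, hqe⟩ := e.monotone.exists_lt_iff_val_lt (i.val + t - K)
    have hqp : q ≤ p := by
      by_contra! h
      have h₁ := hpe ⟨p, by omega⟩
      have h₂ := hqe ⟨p, by omega⟩
      simp only at h₁ h₂
      omega
    have hPpq : ∀ j, j ∈ P ↔ (j : ℕ) < q ∨ p ≤ (j : ℕ) := fun j => by
      have := heK j
      rw [hPmem, ← hqe, ← not_lt (b := p), ← hpe]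
      omega
    have hP : P.map Fin.valEmbedding = Finset.range q ∪ Finset.Ico p n := by
      ext x
      simp only [Finset.mem_map, Fin.valEmbedding_apply, Finset.mem_union, Finset.mem_range,
        Finset.mem_Ico, hPpq]
      exact ⟨by rintro ⟨j, hj, rfl⟩; omega, fun h => ⟨⟨x, by omega⟩, by simp only; omega, rfl⟩⟩
    have hdisj : Disjoint (Finset.range q) (Finset.Ico p n) :=
      Finset.disjoint_left.2 fun x hx hx' => by
        rw [Finset.mem_range] at hx
        rw [Finset.mem_Ico] at hx'
        omega
    rw [hP, Finset.card_union_of_disjoint hdisj, Finset.card_range, Nat.card_Ico] at hPcard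
    refine isCycInterval_image_of_mem_iff hp htn fun j => ?_
    rw [hPpq]
    omega
end
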